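/- arXiv:2204.10518 — 5 statements merged into one kernel-verified Lean document; each statement's English description precedes it below -/
import Mathlib

section
/- Let F be a field and let S be a cancellative semigroup such that the semigroup algebra FS is a centrally essential ring. Then for every non-zero-divisor b ∈ FS, there exists a non-zero-divisor x ∈ FS such that xb ∈ Z(FS). -/
/-- A (not necessarily unital) ring `R` is centrally essential if for every element `a`
not lying in the center, there exist nonzero central elements `x, y` with `a * x = y`. -/
def IsCentrallyEssential (R : Type*) [NonUnitalNonAssocSemiring R] : Prop :=
  ∀ a : R, a ∉ Set.center R →
    ∃ x y : R, x ∈ Set.center R ∧ y ∈ Set.center R ∧ x ≠ 0 ∧ y ≠ 0 ∧ a * x = y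

/-- An element `r` is a (two-sided) non-zero-divisor. -/
def IsNonZeroDivisor {R : Type*} [NonUnitalNonAssocSemiring R] (r : R) : Prop :=
  (∀ x : R, r * x = 0 → x = 0) ∧ (∀ x : R, x * r = 0 → x = 0)

section Dietzmann

variable {Q : Type*} [Monoid Q] {W : Set Q}

theorem exists_list_prod_mul_eq (hconj : ∀ w ∈ W, ∀ u ∈ W, ∃ v ∈ W, w * u = v * w)
    {w : Q} (hw : w ∈ W) (l : List Q) (hl : ∀ x ∈ l, x ∈ W) :
    ∃ l' : List Q, (∀ x ∈ l', x ∈ W) ∧ l'.length = l.length ∧ w * l.prod = l'.prod * w := by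
  induction l with
  | nil => exact ⟨[], by simp, rfl, by simp⟩
  | cons x l ih =>
    simp only [List.mem_cons, forall_eq_or_imp] at hl
    obtain ⟨l', hl', hlen, hprod⟩ := ih hl.2
    obtain ⟨v, hv, hvw⟩ := hconj w hw x hl.1
    refine ⟨v :: l', by simpa using ⟨hv, hl'⟩, by simp [hlen], ?_⟩
    rw [List.prod_cons, List.prod_cons, ← mul_assoc, hvw, mul_assoc, hprod, mul_assoc]

theorem exists_list_prod_eq_mul_pow [DecidableEq Q]
    (hconj : ∀ w ∈ W, ∀ u ∈ W, ∃ v ∈ W, w * u = v * w) {w : Q} (hw : w ∈ W) (l : List Q)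
    (hl : ∀ x ∈ l, x ∈ W) (k : ℕ) (hk : k ≤ l.count w) :
    ∃ l' : List Q, (∀ x ∈ l', x ∈ W) ∧ l'.length + k = l.length ∧ l.prod = l'.prod * w ^ k := by
  induction l generalizing k with
  | nil => exact ⟨[], by simp, by simpa using hk, by simp_all⟩
  | cons x l ih =>
    have hl₀ := hl
    simp only [List.mem_cons, forall_eq_or_imp] at hl
    by_cases hx : x = w
    · subst hx
      cases k with
      | zero => exact ⟨x :: l, hl₀, rfl, by simp⟩
      | succ k =>
        obtain ⟨l', hl', hlen, hprod⟩ := ih hl.2 k (by simpa using hk)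
        obtain ⟨l'', hl'', hlen', hprod'⟩ := exists_list_prod_mul_eq hconj hl.1 l' hl'
        refine ⟨l'', hl'', by simp; omega, ?_⟩
        rw [List.prod_cons, hprod, ← mul_assoc, hprod', mul_assoc, pow_succ']
    · obtain ⟨l', hl', hlen, hprod⟩ := ih hl.2 k (by simpa [List.count_cons, hx] using hk)
      refine ⟨x :: l', by simpa using ⟨hl.1, hl'⟩, by simp; omega, ?_⟩
      rw [List.prod_cons, hprod, List.prod_cons, mul_assoc]

/-- **Dietzmann's lemma**: a finite set of torsion elements which is stable under conjugation by
its own elements generates a finite submonoid. -/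
theorem Submonoid.finite_closure_of_conj_of_torsion (hW : W.Finite)
    (hconj : ∀ w ∈ W, ∀ u ∈ W, ∃ v ∈ W, w * u = v * w)
    (htors : ∀ w ∈ W, ∃ n, 0 < n ∧ w ^ n = 1) :
    (Submonoid.closure W : Set Q).Finite := by
  classical
  choose! e he hpow using htors
  set N := ∑ w ∈ hW.toFinset, e w
  have key : ∀ n, ∀ l : List Q, l.length = n → (∀ x ∈ l, x ∈ W) →
      ∃ l' : List Q, (∀ x ∈ l', x ∈ W) ∧ l'.length ≤ N ∧ l.prod = l'.prod := by
    intro n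
    induction n using Nat.strong_induction_on with
    | _ n ih =>
      intro l hn hl
      by_cases hN : l.length ≤ N
      · exact ⟨l, hl, hN, rfl⟩
      have : ∃ w ∈ W, e w ≤ l.count w := by
        by_contra! hcon
        apply hN
        have hsum := Multiset.sum_count_eq_card (s := hW.toFinset) (m := (l : Multiset Q))
          (by simpa using hl)
        simp only [Multiset.coe_count, Multiset.coe_card] at hsum
        rw [← hsum]
        exact Finset.sum_le_sum fun w hw => (hcon w (by simpa using hw)).le
      obtain ⟨w, hw, hcount⟩ := this
      obtain ⟨l', hl', hlen, hprod⟩ := exists_list_prod_eq_mul_pow hconj hw l hl _ hcount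
      obtain ⟨l'', hl'', hlen', hprod'⟩ := ih l'.length (by have := he w hw; omega) l' rfl hl'
      exact ⟨l'', hl'', hlen', by rw [hprod, hpow w hw, mul_one, hprod']⟩
  have := hW.to_subtype
  refine ((List.finite_length_le W N).image fun l => (l.map Subtype.val).prod).subset ?_
  intro q hq
  obtain ⟨l, hl, rfl⟩ := Submonoid.exists_list_of_mem_closure hq
  obtain ⟨l', hl', hlen, hprod⟩ := key _ l rfl hl
  lift l' to List W using hl'
  exact ⟨l', by simpa using hlen, hprod.symm⟩

end Dietzmann

section FC

variable {S : Type*} [Semigroup S]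

/-- A set `U` is stable under conjugation if `t * u ∈ U * t` for all `t` and all `u ∈ U`. -/
def IsConjStable (U : Set S) : Prop :=
  ∀ t, ∀ u ∈ U, ∃ v ∈ U, t * u = v * t

/-- A semigroup form of the condition that all conjugacy classes are finite: every element is a
right quotient of two elements of a finite conjugation-stable set. -/
def IsFCSemigroup (S : Type*) [Semigroup S] : Prop :=
  ∀ s : S, ∃ U : Set S, U.Finite ∧ IsConjStable U ∧ ∃ a ∈ U, s * a ∈ U

theorem IsFCSemigroup.exists_finite_isConjStable (h : IsFCSemigroup S) {T : Set S}
    (hT : T.Finite) :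
    ∃ U : Set S, U.Finite ∧ IsConjStable U ∧ ∀ s ∈ T, ∃ a ∈ U, s * a ∈ U := by
  choose V hV hconj a ha hsa using h
  refine ⟨⋃ s ∈ T, V s, hT.biUnion fun s _ => hV s, ?_, fun s hs =>
    ⟨a s, Set.mem_biUnion hs (ha s), Set.mem_biUnion hs (hsa s)⟩⟩
  intro t u hu
  obtain ⟨s, hs, hus⟩ := Set.mem_iUnion₂.1 hu
  obtain ⟨v, hv, hvt⟩ := hconj s t u hus
  exact ⟨v, Set.mem_biUnion hs hv, hvt⟩

/-- The power `t ^ (n + 1)` in a semigroup. -/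
def succPow (t : S) : ℕ → S
  | 0 => t
  | n + 1 => t * succPow t n

theorem map_succPow {Q : Type*} [Monoid Q] (π : S →ₙ* Q) (t : S) (n : ℕ) :
    π (succPow t n) = π t ^ (n + 1) := by
  induction n with
  | zero => simp [succPow]
  | succ n ih => rw [succPow, map_mul, ih, pow_succ' _ (n + 1)]

theorem mul_succPow {t w v : S} (h : t * w = v * t) (n : ℕ) :
    t * succPow w n = succPow v n * t := by
  induction n with
  | zero => exact h
  | succ n ih => rw [succPow, succPow, ← mul_assoc, h, mul_assoc, ih, mul_assoc]

variable [IsCancelMul S]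

theorem IsConjStable.exists_succPow_commute {U : Set S} (hU : U.Finite) (hconj : IsConjStable U)
    (t : S) : ∃ n, ∀ u ∈ U, Commute (succPow t n) u := by
  choose! f hf hfu using hconj t
  have := hU.to_subtype
  let g : U → U := fun u => ⟨f u, hf u u.2⟩
  have hg : Function.Injective g := fun u v huv => by
    have : f u = f v := congrArg Subtype.val huv
    exact Subtype.ext (mul_left_cancel (a := t) (by rw [hfu u u.2, hfu v v.2, this]))
  let σ : Equiv.Perm U := Equiv.ofBijective g (Finite.injective_iff_bijective.1 hg)
  have hσ : ∀ u : U, t * (u : S) = (σ u : S) * t := fun u => hfu u u.2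
  have hpow : ∀ n, ∀ u : U, succPow t n * (u : S) = ((σ ^ (n + 1)) u : S) * succPow t n := by
    intro n
    induction n with
    | zero => simpa [succPow] using hσ
    | succ n ih =>
      intro u
      rw [succPow, mul_assoc, ih, ← mul_assoc, hσ, mul_assoc, pow_succ' σ (n + 1),
        Equiv.Perm.mul_apply]
  refine ⟨orderOf σ - 1, fun u hu => ?_⟩
  have := hpow (orderOf σ - 1) ⟨u, hu⟩
  rw [Nat.sub_add_cancel (orderOf_pos σ), pow_orderOf_eq_one] at this
  exact this

theorem IsFCSemigroup.exists_succPow_mem_center (h : IsFCSemigroup S) {U : Set S} (hU : U.Finite)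
    (hconj : IsConjStable U) {w : S} (hw : w ∈ U) : ∃ n, ∀ t, Commute (succPow w n) t := by
  classical
  let f : S → S := fun v => if hv : ∃ t, t * w = v * t then hv.choose else w
  have hf : ∀ t v, t * w = v * t → f v * w = v * f v := fun t v hv => by
    have hv' : ∃ t, t * w = v * t := ⟨t, hv⟩
    simpa only [f, dif_pos hv'] using hv'.choose_spec
  obtain ⟨V, hV, hVconj, hVU⟩ := h.exists_finite_isConjStable (hU.image f)
  obtain ⟨n, hn⟩ := hVconj.exists_succPow_commute hV w
  refine ⟨n, fun t => ?_⟩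
  obtain ⟨v, hv, htv⟩ := hconj t w hw
  obtain ⟨a, ha, hfa⟩ := hVU (f v) ⟨v, hv, rfl⟩
  have hcomm : succPow w n * f v = f v * succPow w n := by
    apply mul_right_cancel (b := a)
    rw [mul_assoc, (hn _ hfa).eq, mul_assoc, mul_assoc, (hn _ ha).eq]
  have hvw : succPow v n = succPow w n := by
    apply mul_right_cancel (b := f v)
    rw [← mul_succPow (hf t v htv), hcomm]
  rw [Commute, SemiconjBy, mul_succPow htv, hvw]

theorem IsFCSemigroup.exists_mul_commute (h : IsFCSemigroup S) (s : S) :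
    ∃ t, ∀ u, Commute (s * t) u := by
  obtain ⟨U, hU, hconj, a, ha, hsa⟩ := h s
  obtain ⟨n, hn⟩ := h.exists_succPow_mem_center hU hconj hsa
  cases n with
  | zero => exact ⟨a, hn⟩
  | succ n => exact ⟨a * succPow (s * a) n, by rwa [← mul_assoc]⟩

end FC

section CentralQuotient

universe u

variable {S : Type u} [Semigroup S]

/-- The congruence identifying elements that agree up to central factors. -/
def centralCon (S : Type*) [Semigroup S] (z₀ : S) (hz₀ : ∀ t, Commute z₀ t) : Con S where
  r s t := ∃ z w, (∀ u, Commute z u) ∧ (∀ u, Commute w u) ∧ z * s = w * t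
  iseqv :=
    { refl := fun s => ⟨z₀, z₀, hz₀, hz₀, rfl⟩
      symm := fun ⟨z, w, hz, hw, h⟩ => ⟨w, z, hw, hz, h.symm⟩
      trans := fun {s t u} ⟨z, w, hz, hw, h⟩ ⟨z', w', hz', hw', h'⟩ =>
        ⟨z' * z, w * w', fun u => (hz' u).mul_left (hz u), fun u => (hw u).mul_left (hw' u), by
          rw [mul_assoc, h, ← mul_assoc, (hz' w).eq, mul_assoc, h', mul_assoc]⟩ }
  mul' := fun {s t u v} ⟨z, w, hz, hw, h⟩ ⟨z', w', hz', hw', h'⟩ =>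
    ⟨z * z', w * w', fun u => (hz u).mul_left (hz' u), fun u => (hw u).mul_left (hw' u), by
      rw [mul_assoc, ← mul_assoc z' s u, (hz' s).eq, mul_assoc s, h', ← mul_assoc, h, mul_assoc,
        ← mul_assoc t w' v, ← (hw' t).eq, mul_assoc w, mul_assoc w']⟩

theorem exists_monoid_quotient_center (z₀ : S) (hz₀ : ∀ t, Commute z₀ t) :
    ∃ (Q : Type u) (_ : Monoid Q) (π : S →ₙ* Q), Function.Surjective π ∧
      (∀ z, (∀ t, Commute z t) → π z = 1) ∧
      ∀ s t, π s = π t → ∃ z w, (∀ u, Commute z u) ∧ (∀ u, Commute w u) ∧ z * s = w * t := by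
  let c := centralCon S z₀ hz₀
  have hone : ∀ q : c.Quotient, (z₀ : c.Quotient) * q = q := by
    rintro ⟨s⟩
    exact (c.eq).2 ⟨z₀, z₀ * z₀, hz₀, fun u => (hz₀ u).mul_left (hz₀ u), (mul_assoc _ _ _).symm⟩
  have hone' : ∀ q : c.Quotient, q * (z₀ : c.Quotient) = q := by
    rintro ⟨s⟩
    refine Eq.trans ?_ (hone (s : c.Quotient))
    exact congrArg ((↑) : S → c.Quotient) (hz₀ s).symm.eq
  let _ : Monoid c.Quotient :=
    { (inferInstance : Semigroup c.Quotient) with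
      one := (z₀ : c.Quotient)
      one_mul := hone
      mul_one := hone' }
  refine ⟨c.Quotient, inferInstance, ⟨(↑), fun _ _ => rfl⟩, Quotient.mk''_surjective, ?_, ?_⟩
  · intro z hz
    exact (c.eq).2 ⟨z₀, z, hz₀, hz, (hz₀ z).eq⟩
  · intro s t hst
    exact (c.eq).1 hst

end CentralQuotient

section Determinant

open Matrix

/-- An injective endomorphism preserving the span of a finite linearly independent family acts on
that family through a matrix with regular determinant, and its range contains the multiples of the
family by this determinant. -/
theorem LinearIndependent.exists_nonZeroDivisor_smul_mem_range {K R D : Type*} [CommRing K]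
    [AddCommGroup R] [Module K R] [Fintype D] [DecidableEq D] {t : D → R}
    (ht : LinearIndependent K t) {β : R →ₗ[K] R} (hβ : Function.Injective β) (M : Matrix D D K)
    (hM : ∀ j, β (t j) = ∑ i, M i j • t i) :
    ∃ d ∈ nonZeroDivisors K, ∀ i, ∃ x, β x = d • t i := by
  have hsum : ∀ v : D → K, β (∑ j, v j • t j) = ∑ i, (M *ᵥ v) i • t i := fun v => by
    simp only [map_sum, map_smul, hM, Finset.smul_sum, Matrix.mulVec, dotProduct, Finset.sum_smul,
      smul_smul]
    rw [Finset.sum_comm]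
    simp only [mul_comm]
  refine ⟨M.det, nonsingular_iff_det_mem_nonZeroDivisors.1 (.of_linearIndependent_col ?_),
    fun i => ⟨∑ j, (M.adjugate *ᵥ Pi.single i 1) j • t j, ?_⟩⟩
  · rw [← Matrix.mulVec_injective_iff, ← Matrix.coe_mulVecLin, injective_iff_map_eq_zero]
    intro v hv
    have h0 : β (∑ j, v j • t j) = β 0 := by
      rw [hsum, map_zero]
      have : M *ᵥ v = 0 := hv
      simp [this]
    exact funext (Fintype.linearIndependent_iff.1 ht v (hβ h0))
  · rw [hsum, Matrix.mulVec_mulVec, Matrix.mul_adjugate, Matrix.smul_mulVec, Matrix.one_mulVec]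
    rw [Finset.sum_eq_single i (by simp +contextual) (by simp)]
    simp

end Determinant

section SemigroupAlgebra

open MonoidAlgebra

variable {F : Type*} [Field F] {S : Type*} [Semigroup S]

theorem exists_common_center_multiple {S : Type*} [Semigroup S] {z₀ : S}
    (hz₀ : ∀ t, Commute z₀ t) {ι : Type*} (I : Finset ι)
    (z : ι → S) (hz : ∀ i ∈ I, ∀ t, Commute (z i) t) :
    ∃ ζ, (∀ t, Commute ζ t) ∧ ∀ i ∈ I, ∃ w, (∀ t, Commute w t) ∧ ζ = w * z i := by
  classical
  induction I using Finset.induction_on with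
  | empty => exact ⟨z₀, hz₀, by simp⟩
  | insert i I _ ih =>
    obtain ⟨ζ, hζ, h⟩ := ih fun j hj => hz j (Finset.mem_insert_of_mem hj)
    have hzi := hz i (Finset.mem_insert_self _ _)
    refine ⟨ζ * z i, fun t => (hζ t).mul_left (hzi t), fun j hj => ?_⟩
    obtain rfl | hj := Finset.mem_insert.1 hj
    · exact ⟨ζ, hζ, rfl⟩
    · obtain ⟨w, hw, rfl⟩ := h j hj
      exact ⟨w * z i, fun t => (hw t).mul_left (hzi t), by
        rw [mul_assoc, mul_assoc, (hzi _).eq]⟩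

theorem single_mem_center {z : S} (hz : ∀ t, Commute z t) (c : F) :
    (single z c : MonoidAlgebra F S) ∈ Set.center (MonoidAlgebra F S) :=
  Semigroup.mem_center_iff.2 fun r => (single_commute hz (Commute.all c) r).eq.symm

theorem commute_of_single_mem_center {s : S}
    (hs : (single s 1 : MonoidAlgebra F S) ∈ Set.center (MonoidAlgebra F S)) (t : S) :
    Commute s t := by
  have := Semigroup.mem_center_iff.1 hs (single t 1)
  rw [single_mul_single, single_mul_single] at this
  exact (single_left_injective (R := F) (by simp : (1 * 1 : F) ≠ 0) this).symm

theorem IsConjStable.singleton {s : S} (hs : ∀ t, Commute s t) : IsConjStable ({s} : Set S) := by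
  rintro t _ rfl
  exact ⟨_, rfl, (hs t).symm.eq⟩

theorem IsConjStable.union {U V : Set S} (hU : IsConjStable U) (hV : IsConjStable V) :
    IsConjStable (U ∪ V) := by
  rintro t u (hu | hu)
  · obtain ⟨v, hv, h⟩ := hU t u hu
    exact ⟨v, .inl hv, h⟩
  · obtain ⟨v, hv, h⟩ := hV t u hu
    exact ⟨v, .inr hv, h⟩

section Cancel

variable [IsCancelMul S]

theorem isConjStable_support_of_mem_center {x : MonoidAlgebra F S}
    (hx : x ∈ Set.center (MonoidAlgebra F S)) : IsConjStable (x.coeff.support : Set S) := by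
  classical
  intro t u hu
  have htu : t * u ∈ (single t 1 * x).coeff.support := by
    rw [support_coeff_single_mul x 1 (by simp)]
    exact Finset.mem_map_of_mem (mulLeftEmbedding t) hu
  rw [Semigroup.mem_center_iff.1 hx, support_coeff_mul_single x 1 (by simp)] at htu
  obtain ⟨v, hv, hvt⟩ := Finset.mem_map.1 htu
  exact ⟨v, hv, hvt.symm⟩

theorem IsCentrallyEssential.isFCSemigroup (h : IsCentrallyEssential (MonoidAlgebra F S)) :
    IsFCSemigroup S := by
  intro s
  by_cases hs : (single s 1 : MonoidAlgebra F S) ∈ Set.center (MonoidAlgebra F S)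
  · have hs' := commute_of_single_mem_center hs
    exact ⟨{s} ∪ {s * s}, by simp, (IsConjStable.singleton hs').union
      (.singleton fun t => (hs' t).mul_left (hs' t)), s, by simp, by simp⟩
  · obtain ⟨x, y, hx, hy, hx0, -, hxy⟩ := h _ hs
    obtain ⟨a, ha⟩ : x.coeff.support.Nonempty := by simpa using hx0
    refine ⟨x.coeff.support ∪ y.coeff.support,
      (Finset.finite_toSet _).union (Finset.finite_toSet _),
      (isConjStable_support_of_mem_center hx).union (isConjStable_support_of_mem_center hy), a,
      .inl ha, .inr ?_⟩
    rw [← hxy, support_coeff_single_mul x 1 (by simp)]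
    exact Finset.mem_coe.2 (Finset.mem_map_of_mem (mulLeftEmbedding s) ha)

end Cancel

variable {Q : Type*} [Monoid Q] (π : S →ₙ* Q)

/-- The projection of the semigroup algebra onto the span of a fibre of `π`. -/
noncomputable def fibreProj (q : Q) : Module.End F (MonoidAlgebra F S) :=
  open Classical in
  { toFun := fun r => ofCoeff (r.coeff.filter (π · = q))
    map_add' := fun r r' => by simp [Finsupp.filter_add]
    map_smul' := fun c r => by simp [Finsupp.filter_smul] }

theorem coeff_fibreProj [DecidableEq Q] (q : Q) (r : MonoidAlgebra F S) (s : S) :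
    (fibreProj π q r).coeff s = if π s = q then r.coeff s else 0 := by
  simp only [fibreProj, LinearMap.coe_mk, AddHom.coe_mk, coeff_ofCoeff, Finsupp.filter_apply]
  congr

theorem fibreProj_single [DecidableEq Q] (q : Q) (s : S) (c : F) :
    fibreProj π q (single s c) = if π s = q then single s c else 0 := by
  classical
  ext t
  rw [coeff_fibreProj]
  simp only [coeff_single, Finsupp.single_apply]
  split_ifs <;> simp_all [Finsupp.single_apply]
  rintro rfl
  contradiction

/-- The linear endomorphisms of the semigroup algebra commuting with all left and right
multiplications and with the projections onto the fibres of `π`. -/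
noncomputable def gradedCentroid (F : Type*) [Field F] :
    Subalgebra F (Module.End F (MonoidAlgebra F S)) :=
  Subalgebra.centralizer F
    (Set.range (LinearMap.mulLeft F) ∪ Set.range (LinearMap.mulRight F) ∪ Set.range (fibreProj π))

variable {π}

theorem mem_gradedCentroid {f : Module.End F (MonoidAlgebra F S)} :
    f ∈ gradedCentroid π F ↔ (∀ x y, f (x * y) = x * f y) ∧ (∀ x y, f (x * y) = f x * y) ∧
      ∀ q x, f (fibreProj π q x) = fibreProj π q (f x) := by
  simp only [gradedCentroid, Subalgebra.mem_centralizer_iff, Set.mem_union, or_imp, forall_and,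
    Set.forall_mem_range, LinearMap.ext_iff, Module.End.mul_apply, LinearMap.mulLeft_apply,
    LinearMap.mulRight_apply, and_assoc]
  exact ⟨fun ⟨h, h', h''⟩ => ⟨fun x y => (h x y).symm, fun x y => (h' y x).symm,
    fun q x => (h'' q x).symm⟩, fun ⟨h, h', h''⟩ => ⟨fun x y => (h x y).symm,
    fun x y => (h' y x).symm, fun q x => (h'' q x).symm⟩⟩

theorem smul_eq_apply (f : gradedCentroid π F) (x : MonoidAlgebra F S) :
    f • x = (f : Module.End F (MonoidAlgebra F S)) x := rfl

theorem gradedCentroid_smul_mul (f : gradedCentroid π F) (x y : MonoidAlgebra F S) :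
    f • (x * y) = (f • x) * y :=
  (mem_gradedCentroid.1 f.2).2.1 x y

theorem gradedCentroid_smul_mul' (f : gradedCentroid π F) (x y : MonoidAlgebra F S) :
    f • (x * y) = x * (f • y) :=
  (mem_gradedCentroid.1 f.2).1 x y

theorem gradedCentroid_smul_fibreProj (f : gradedCentroid π F) (q : Q) (x : MonoidAlgebra F S) :
    f • fibreProj π q x = fibreProj π q (f • x) :=
  (mem_gradedCentroid.1 f.2).2.2 q x

theorem mulLeft_mem_gradedCentroid
    (hπ : ∀ z, π z = 1 → ∀ t, Commute z t) {x : MonoidAlgebra F S}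
    (hx : ∀ s ∈ x.coeff.support, π s = 1) :
    LinearMap.mulLeft F x ∈ gradedCentroid π F := by
  classical
  change LinearMap.mul F _ x ∈ _
  rw [← sum_coeff_single x, Finsupp.sum, map_sum]
  refine Subalgebra.sum_mem _ fun s hs => mem_gradedCentroid.2
    ⟨fun y r => ?_, fun y r => ?_, fun q r => ?_⟩
  · simp only [LinearMap.mul_apply']
    rw [← mul_assoc, ← Semigroup.mem_center_iff.1 (single_mem_center (hπ s (hx s hs)) _), mul_assoc]
  · simp [mul_assoc]
  · induction r using MonoidAlgebra.induction_linear with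
    | zero => simp
    | add r r' h h' => simp only [map_add, h, h']
    | single t c =>
      simp only [LinearMap.mul_apply', single_mul_single, fibreProj_single, map_mul, hx s hs,
        one_mul]
      split_ifs <;> simp

section Cancel
variable [IsCancelMul S]

theorem eq_zero_of_single_mul {s : S} {r : MonoidAlgebra F S} (h : single s 1 * r = 0) : r = 0 := by
  have := support_coeff_single_mul r (1 : F) (by simp) s
  rw [h] at this
  simpa [eq_comm] using this

theorem eq_zero_of_mul_single {s : S} {r : MonoidAlgebra F S} (h : r * single s 1 = 0) : r = 0 := by
  have := support_coeff_mul_single r (1 : F) (by simp) s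
  rw [h] at this
  simpa [eq_comm] using this

theorem gradedCentroid_mul_comm (s : S) (f g : gradedCentroid π F) : f * g = g * f := by
  refine Subtype.ext (LinearMap.ext fun x => ?_)
  have h : (f * g) • (single s 1 * x) = (g * f) • (single s 1 * x) := by
    rw [mul_smul, mul_smul, gradedCentroid_smul_mul g, gradedCentroid_smul_mul' f,
      gradedCentroid_smul_mul' f, gradedCentroid_smul_mul g]
  rw [gradedCentroid_smul_mul', gradedCentroid_smul_mul', ← sub_eq_zero, ← mul_sub] at h
  exact sub_eq_zero.1 (eq_zero_of_single_mul h)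

theorem eq_zero_of_smul_single {s : S} {f : gradedCentroid π F}
    (h : f • (single s 1 : MonoidAlgebra F S) = 0) : f = 0 := by
  refine Subtype.ext (LinearMap.ext fun x => eq_zero_of_single_mul (s := s) ?_)
  rw [← smul_eq_apply, ← gradedCentroid_smul_mul', gradedCentroid_smul_mul, h, zero_mul]

/-- The semigroup algebra is torsion-free over the commutative ring `gradedCentroid π F`. -/
theorem eq_zero_of_nonZeroDivisor_smul (hπ : ∀ z, π z = 1 → ∀ t, Commute z t)
    (hinv : ∀ s, ∃ t, π (s * t) = 1) {d : gradedCentroid π F}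
    (hd : ∀ f, d * f = 0 → f = 0) {r : MonoidAlgebra F S} (hr : d • r = 0) : r = 0 := by
  classical
  by_contra hr0
  obtain ⟨s, hs⟩ : r.coeff.support.Nonempty := by simpa using hr0
  obtain ⟨t, ht⟩ := hinv s
  set x := fibreProj π (π s) r * single t 1 with hx
  have hxsupp : ∀ u ∈ x.coeff.support, π u = 1 := by
    intro u hu
    rw [hx, support_coeff_mul_single _ 1 (by simp)] at hu
    obtain ⟨v, hv, rfl⟩ := Finset.mem_map.1 hu
    rw [Finsupp.mem_support_iff, coeff_fibreProj] at hv
    have hvs : π v = π s := by by_contra hne; simp [hne] at hv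
    change π (v * t) = 1
    rw [map_mul, hvs, ← map_mul, ht]
  have hdx : d • x = 0 := by
    rw [gradedCentroid_smul_mul, gradedCentroid_smul_fibreProj, hr, map_zero, zero_mul]
  have hzero := hd ⟨_, mulLeft_mem_gradedCentroid hπ hxsupp⟩ <| Subtype.ext <| LinearMap.ext
    fun y => (gradedCentroid_smul_mul d x y).trans (by rw [hdx, zero_mul]; rfl)
  have hxs : x * single s 1 = 0 :=
    congrArg (fun f : gradedCentroid π F => f • (single s 1 : MonoidAlgebra F S)) hzero
  have hproj := eq_zero_of_mul_single (eq_zero_of_mul_single hxs)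
  have := congrArg (fun y => y.coeff s) hproj
  simp [coeff_fibreProj] at this
  simp [this] at hs

theorem IsFCSemigroup.exists_mul_mem_center [Nonempty S] (h : IsFCSemigroup S)
    {b : MonoidAlgebra F S} (hb : IsNonZeroDivisor b) :
    ∃ x : MonoidAlgebra F S, IsNonZeroDivisor x ∧ x * b ∈ Set.center (MonoidAlgebra F S) := by
  classical
  obtain ⟨z₀, hz₀⟩ : ∃ z₀ : S, ∀ t, Commute z₀ t :=
    let ⟨_, ht⟩ := h.exists_mul_commute (Classical.arbitrary S)
    ⟨_, ht⟩
  obtain ⟨Q, _, π, hsurj, hone, hker⟩ := exists_monoid_quotient_center z₀ hz₀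
  have hcent : ∀ z, π z = 1 → ∀ t, Commute z t := by
    intro z hz t
    obtain ⟨u, w, hu, hw, huw⟩ := hker z z₀ (hz.trans (hone z₀ hz₀).symm)
    apply mul_left_cancel (a := u)
    rw [← mul_assoc, huw, ← mul_assoc, (hu t).eq, mul_assoc t u z, huw,
      ((hw t).mul_left (hz₀ t)).eq]
  have hinv : ∀ s, ∃ t, π (s * t) = 1 := fun s =>
    (h.exists_mul_commute s).imp fun t ht => hone _ ht
  obtain ⟨P, hP, hbP⟩ : ∃ P : Submonoid Q, (P : Set Q).Finite ∧ ∀ s ∈ b.coeff.support, π s ∈ P := by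
    obtain ⟨U, hU, hconj, hbU⟩ := h.exists_finite_isConjStable b.coeff.support.finite_toSet
    have htors : ∀ u ∈ U, ∃ n, π u ^ (n + 1) = 1 := fun u hu => by
      obtain ⟨n, hn⟩ := h.exists_succPow_mem_center hU hconj hu
      exact ⟨n, by rw [← map_succPow, hone _ hn]⟩
    refine ⟨Submonoid.closure (π '' U), Submonoid.finite_closure_of_conj_of_torsion (hU.image π)
      ?_ ?_, fun s hs => ?_⟩
    · rintro _ ⟨w, -, rfl⟩ _ ⟨u, hu, rfl⟩
      obtain ⟨v, hv, hvw⟩ := hconj w u hu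
      exact ⟨π v, ⟨v, hv, rfl⟩, by rw [← map_mul, hvw, map_mul]⟩
    · rintro _ ⟨w, hw, rfl⟩
      obtain ⟨n, hn⟩ := htors w hw
      exact ⟨n + 1, n.succ_pos, hn⟩
    · obtain ⟨a, ha, hsa⟩ := hbU s hs
      obtain ⟨n, hn⟩ := htors a ha
      have : π s = π (s * a) * π a ^ n := by
        rw [map_mul, mul_assoc, ← pow_succ', hn, mul_one]
      rw [this]
      exact mul_mem (Submonoid.subset_closure (Set.mem_image_of_mem π hsa))
        (pow_mem (Submonoid.subset_closure (Set.mem_image_of_mem π ha)) _)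
  have : Fintype P := hP.fintype
  obtain ⟨τ, hτ⟩ := hsurj.hasRightInverse
  obtain ⟨ζ, hζ, κ, hκ⟩ : ∃ ζ : S, (∀ t, Commute ζ t) ∧ ∃ κ : S → P → gradedCentroid π F,
      ∀ s ∈ b.coeff.support, ∀ q : P, (single ζ 1 * single (s * τ q) 1 : MonoidAlgebra F S) =
        κ s q • single (τ (π s * q)) 1 := by
    have hrel : ∀ s q, π (s * τ q) = π (τ (π s * q)) := fun s q => by rw [map_mul, hτ, hτ]
    choose z w hz hw hzw using fun (s : S) (q : P) => hker _ _ (hrel s q)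
    obtain ⟨ζ, hζ, hmul⟩ := exists_common_center_multiple hz₀ (b.coeff.support ×ˢ Finset.univ)
      (fun i : S × P => z i.1 i.2) fun i _ => hz i.1 i.2
    have hex : ∀ s ∈ b.coeff.support, ∀ q : P, ∃ k : gradedCentroid π F,
        (single ζ 1 * single (s * τ q) 1 : MonoidAlgebra F S) =
          k • single (τ (π s * q)) 1 := by
      intro s hs q
      obtain ⟨v, hv, hvz⟩ := hmul (s, q) (by simpa using hs)
      refine ⟨⟨LinearMap.mulLeft F (single (v * w s q) 1),
        mulLeft_mem_gradedCentroid hcent fun t ht => ?_⟩, ?_⟩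
      · rw [Finset.mem_singleton.1 (Finsupp.support_single_subset ht), map_mul, hone _ hv,
          hone _ (hw s q), one_mul]
      · rw [smul_eq_apply, LinearMap.mulLeft_apply, single_mul_single, single_mul_single, hvz,
          mul_assoc v, hzw, mul_assoc]
    choose! κ hκ using hex
    exact ⟨ζ, hζ, κ, hκ⟩
  let _ : CommRing (gradedCentroid π F) :=
    { (inferInstance : Ring (gradedCentroid π F)) with
      mul_comm := gradedCentroid_mul_comm z₀ }
  have hli : LinearIndependent (gradedCentroid π F)
      (fun q : P => (single (τ q) 1 : MonoidAlgebra F S)) := by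
    rw [Fintype.linearIndependent_iff]
    intro v hv i
    apply eq_zero_of_smul_single (s := τ i)
    have := congrArg (fibreProj π (i : Q)) hv
    rw [map_sum, map_zero, Finset.sum_eq_single i _ (by simp), ← gradedCentroid_smul_fibreProj,
      fibreProj_single, if_pos (hτ i)] at this
    · exact this
    · intro j _ hj
      rw [← gradedCentroid_smul_fibreProj, fibreProj_single, hτ, if_neg (by simpa using hj),
        smul_zero]
  let β : MonoidAlgebra F S →ₗ[gradedCentroid π F] MonoidAlgebra F S :=
    { toFun := fun r => single ζ 1 * b * r
      map_add' := mul_add _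
      map_smul' := fun f r => (gradedCentroid_smul_mul' f _ r).symm }
  have hβ : Function.Injective β := by
    rw [injective_iff_map_eq_zero]
    intro r hr
    exact hb.1 r (eq_zero_of_single_mul (s := ζ) ((mul_assoc _ _ _).symm.trans hr))
  obtain ⟨d, hd, hrange⟩ := hli.exists_nonZeroDivisor_smul_mem_range hβ
    (fun i j => ∑ s ∈ b.coeff.support, if (i : Q) = π s * j then b.coeff s • κ s j else 0) <| by
    intro j
    change single ζ 1 * b * single (τ j) 1 = _
    conv_lhs => rw [← sum_coeff_single b, Finsupp.sum, Finset.mul_sum, Finset.sum_mul]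
    simp only [Finset.sum_smul]
    rw [Finset.sum_comm]
    refine Finset.sum_congr rfl fun s hs => ?_
    rw [Finset.sum_eq_single ⟨π s * j, mul_mem (hbP s hs) j.2⟩ _
      fun hn => absurd (Finset.mem_univ _) hn]
    · rw [if_pos rfl, smul_assoc, ← hκ s hs]
      simp [mul_assoc]
    · intro i _ hi
      rw [if_neg fun hij => hi (Subtype.ext hij), zero_smul]
  obtain ⟨x, hx⟩ := hrange 1
  set y := d • (single (τ (1 : P)) 1 : MonoidAlgebra F S) with hy
  have hτ1 : ∀ r : MonoidAlgebra F S, r * single (τ (1 : P)) 1 = single (τ (1 : P)) 1 * r :=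
    Semigroup.mem_center_iff.1 (single_mem_center (hcent _ (hτ _)) 1)
  have hyc : ∀ r, r * y = y * r := fun r => by
    rw [hy, ← gradedCentroid_smul_mul', hτ1, gradedCentroid_smul_mul]
  have hy0 : ∀ r, y * r = 0 → r = 0 := fun r hr => by
    rw [hy, ← gradedCentroid_smul_mul] at hr
    exact eq_zero_of_single_mul (eq_zero_of_nonZeroDivisor_smul hcent hinv
      (fun f hf => (mem_nonZeroDivisors_iff.1 hd).1 f hf) hr)
  have hbx : b * (x * single ζ 1) = y := by
    rw [← hx, ← mul_assoc, Semigroup.mem_center_iff.1 (single_mem_center hζ 1), ← mul_assoc]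
    rfl
  have hxb : x * single ζ 1 * b = y := by
    rw [← sub_eq_zero]
    apply hb.1
    rw [mul_sub, ← mul_assoc, hbx, hyc, sub_self]
  refine ⟨x * single ζ 1, ⟨fun r hr => hy0 r ?_, fun r hr => hy0 r ?_⟩, ?_⟩
  · rw [← hbx, mul_assoc, hr, mul_zero]
  · rw [← hyc, ← hxb, ← mul_assoc, hr, zero_mul]
  · rw [hxb]
    exact Semigroup.mem_center_iff.2 hyc

end Cancel

end SemigroupAlgebra

/-- If `S` is a cancellative semigroup and the semigroup algebra `F[S]` is centrally
essential, then for every non-zero-divisor `b ∈ F[S]` there exists a non-zero-divisor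
`x ∈ F[S]` with `x * b ∈ Z(F[S])`. -/
theorem stmt10 (F : Type*) [Field F] (S : Type*) [Semigroup S] [IsCancelMul S]
    (h : IsCentrallyEssential (MonoidAlgebra F S)) :
    ∀ b : MonoidAlgebra F S, IsNonZeroDivisor b →
      ∃ x : MonoidAlgebra F S, IsNonZeroDivisor x ∧ x * b ∈ Set.center (MonoidAlgebra F S) := by
  intro b hb
  cases isEmpty_or_nonempty S
  · exact ⟨b, hb, Semigroup.mem_center_iff.2 fun _ => MonoidAlgebra.ext (Subsingleton.elim _ _)⟩
  · exact h.isFCSemigroup.exists_mul_mem_center hb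
end

section
/- Let F be a field and let S be a cancellative semigroup such that the semigroup algebra FS is a centrally essential ring. Then FS has a classical (two-sided) ring of fractions, i.e., the set of non-zero-divisors of FS satisfies both the right Ore condition (for any a, b ∈ FS with b a non-zero-divisor there exist c, d ∈ FS with d a non-zero-divisor such that bc = ad) and the left Ore condition (for any a, b ∈ FS with b a non-zero-divisor there exist c, d ∈ FS with d a non-zero-divisor such that cb = da). -/
theorem CommGroup.exists_pow_eq_one_of_isOfFinOrder (G : Type*) [CommGroup G] [Group.FG G] :
    ∃ e ≠ 0, ∀ x : G, IsOfFinOrder x → x ^ e = 1 := by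
  have : Module.Finite ℤ (Additive G) := Module.Finite.iff_addGroup_fg.2 inferInstance
  have : Finite (Submodule.torsion ℤ (Additive G)) :=
    Module.finite_of_fg_torsion _ (Submodule.torsion_isTorsion)
  refine ⟨Nat.card (Submodule.torsion ℤ (Additive G)), Nat.card_pos.ne', fun x hx ↦ ?_⟩
  obtain ⟨n, hn, hx⟩ := isOfFinOrder_iff_pow_eq_one.1 hx
  have hmem : Additive.ofMul x ∈ Submodule.torsion ℤ (Additive G) := by
    refine (Submodule.mem_torsion_iff _).2
      ⟨⟨n, mem_nonZeroDivisors_of_ne_zero (by exact_mod_cast hn.ne')⟩, ?_⟩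
    change (n : ℤ) • Additive.ofMul x = 0
    rw [natCast_zsmul, ← ofMul_pow, hx, ofMul_one]
  exact congrArg (Subtype.val ·)
    (card_nsmul_eq_zero' (x := (⟨_, hmem⟩ : Submodule.torsion ℤ (Additive G))))

theorem exists_pow_eq_pow_of_pow_eq_pow (Z : Type*) [CancelCommMonoid Z] [Monoid.FG Z] :
    ∃ e ≠ 0, ∀ (x y : Z) (m : ℕ), m ≠ 0 → x ^ m = y ^ m → x ^ e = y ^ e := by
  have : Group.FG (Algebra.GrothendieckGroup Z) :=
    Group.fg_iff_monoid_fg.2 inferInstance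
  obtain ⟨e, he, h⟩ := CommGroup.exists_pow_eq_one_of_isOfFinOrder (Algebra.GrothendieckGroup Z)
  refine ⟨e, he, fun x y m hm hxy ↦ Algebra.GrothendieckGroup.of_injective ?_⟩
  rw [map_pow, map_pow, ← div_eq_one, ← div_pow]
  refine h _ (isOfFinOrder_iff_pow_eq_one.2 ⟨m, Nat.pos_of_ne_zero hm, ?_⟩)
  rw [div_pow, ← map_pow, ← map_pow, hxy, div_self']

/-- A free action of a commutative monoid with unique products by injective maps again has the
unique product property. -/
theorem exists_unique_act {C X : Type*} [CommMonoid C] [UniqueProds C]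
    (act : C → X → X) (act_mul : ∀ c d x, act (c * d) x = act c (act d x))
    (act_inj : ∀ c, Function.Injective (act c))
    (act_free : ∀ x, Function.Injective (act · x))
    {A : Finset C} {B : Finset X} (hA : A.Nonempty) (hB : B.Nonempty) :
    ∃ a₀ ∈ A, ∃ b₀ ∈ B, ∀ a ∈ A, ∀ b ∈ B, act a b = act a₀ b₀ → a = a₀ ∧ b = b₀ := by
  classical
  obtain ⟨x, hx⟩ := hB
  have comm (c d : C) (x : X) : act c (act d x) = act d (act c x) := by
    rw [← act_mul, mul_comm, act_mul]
  have common (B' : Finset X) (h : ∀ b ∈ B', ∃ c c', act c b = act c' x) :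
      ∃ d, ∀ b ∈ B', ∃ e, act d b = act e x := by
    induction B' using Finset.induction_on with
    | empty => exact ⟨1, by simp⟩
    | insert b B' _ ih =>
      obtain ⟨d, hd⟩ := ih fun b hb ↦ h b (Finset.mem_insert_of_mem hb)
      obtain ⟨c, c', hc⟩ := h b (Finset.mem_insert_self b B')
      refine ⟨c * d, fun y hy ↦ ?_⟩
      rcases Finset.mem_insert.1 hy with rfl | hy
      · exact ⟨d * c', by rw [mul_comm, act_mul, hc, act_mul]⟩
      · obtain ⟨e, he⟩ := hd y hy
        exact ⟨c * e, by rw [act_mul, he, act_mul]⟩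
  set B₀ := B.filter fun b ↦ ∃ c c', act c b = act c' x with hB₀
  obtain ⟨d, hd⟩ := common B₀ (by simp [hB₀])
  choose! e he using hd
  have hxB₀ : x ∈ B₀ := by simpa [hB₀, hx] using ⟨1, 1, rfl⟩
  obtain ⟨a₀, ha₀, e₀, he₀, hu⟩ := UniqueProds.uniqueMul_of_nonempty hA
    (Finset.Nonempty.image ⟨x, hxB₀⟩ e)
  obtain ⟨b₀, hb₀, rfl⟩ := Finset.mem_image.1 he₀
  have hb₀' := Finset.mem_filter.1 hb₀
  refine ⟨a₀, ha₀, b₀, hb₀'.1, fun a ha b hb hab ↦ ?_⟩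
  have hbB₀ : b ∈ B₀ := by
    obtain ⟨c, c', hc⟩ := hb₀'.2
    refine Finset.mem_filter.2 ⟨hb, c * a, a₀ * c', ?_⟩
    rw [act_mul, hab, comm, hc, act_mul]
  obtain ⟨rfl, -⟩ := hu ha (Finset.mem_image_of_mem e hbB₀) <| act_free x <| by
    simp only [act_mul, ← he b hbB₀, ← he b₀ hb₀]
    rw [comm, hab, comm]
  exact ⟨rfl, act_inj a hab⟩

/-- A nonempty finite set `X` such that both `X` and `s * X` are normal in `M`. -/
structure IsNormalPair {M : Type*} [Semigroup M] (s : M) (X : Finset M) : Prop where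
  nonempty : X.Nonempty
  exists_left : ∀ r, ∀ x ∈ X, ∃ x' ∈ X, r * x = x' * r
  exists_right : ∀ r, ∀ x ∈ X, ∃ x' ∈ X, x * r = r * x'
  exists_mul : ∀ r, ∀ x ∈ X, ∃ x' ∈ X, r * (s * x) = s * x' * r

theorem exists_iterate_eq_self (α : Type*) [Finite α] :
    ∃ N ≠ 0, ∀ f : α → α, f.Injective → ∀ x, f^[N] x = x := by
  refine ⟨Nat.card (Equiv.Perm α), Nat.card_pos.ne', fun f hf x ↦ ?_⟩
  have := DFunLike.congr_fun
    (pow_card_eq_one' (x := Equiv.ofBijective f (Finite.injective_iff_bijective.1 hf))) x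
  rw [Equiv.Perm.coe_pow] at this
  simpa using this

namespace IsNormalPair

variable {M : Type*} [Monoid M] {s : M} {X : Finset M}

theorem exists_swap (h : IsNormalPair s X) (r x : M) (hx : x ∈ X) :
    ∃ x' ∈ X, r * (s * x) = s * (r * x') := by
  obtain ⟨x₁, h₁, e₁⟩ := h.exists_mul r x hx
  obtain ⟨x₂, h₂, e₂⟩ := h.exists_right r x₁ h₁
  exact ⟨x₂, h₂, by rw [e₁, mul_assoc, e₂]⟩

theorem exists_swap_pow (h : IsNormalPair s X) (r x : M) (hx : x ∈ X) (n : ℕ) :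
    ∃ x' ∈ X, r * (s ^ n * x) = s ^ n * (r * x') := by
  induction n generalizing x with
  | zero => exact ⟨x, hx, by simp⟩
  | succ n ih =>
    obtain ⟨x₁, h₁, e₁⟩ := h.exists_left (s ^ n) x hx
    obtain ⟨x₂, h₂, e₂⟩ := h.exists_swap r x₁ h₁
    obtain ⟨x₃, h₃, e₃⟩ := h.exists_right (s ^ n) x₂ h₂
    obtain ⟨x₄, h₄, e₄⟩ := ih x₃ h₃
    refine ⟨x₄, h₄, ?_⟩
    rw [pow_succ', mul_assoc s, e₁, ← mul_assoc s, ← mul_assoc r, e₂, mul_assoc, mul_assoc,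
      e₃, e₄, mul_assoc]

theorem exists_pow_comm [IsCancelMul M] (h : IsNormalPair s X) :
    ∃ N ≠ 0, ∀ r, Commute (r ^ N) s := by
  obtain ⟨N, hN, hf⟩ := exists_iterate_eq_self X
  have key (r u : M) (hu : ∀ x ∈ X, ∃ x' ∈ X, r * (u * x) = u * x' * r) (x : X) :
      r ^ N * (u * x) = u * x * r ^ N := by
    choose! f hfX hfe using hu
    let g : X → X := fun x ↦ ⟨f x, hfX x x.2⟩
    have hg : g.Injective := fun x y hxy ↦ by
      have : r * (u * x) = r * (u * y) := by
        rw [hfe x x.2, hfe y y.2, show f x = f y from congrArg Subtype.val hxy]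
      exact Subtype.ext (mul_left_cancel (mul_left_cancel this))
    have it (n : ℕ) : r ^ n * (u * x) = u * (g^[n] x : X) * r ^ n := by
      induction n with
      | zero => simp
      | succ n ih =>
        rw [pow_succ', mul_assoc, ih, ← mul_assoc, hfe _ (Subtype.prop _), mul_assoc,
          Function.iterate_succ_apply']
    rw [it, hf g hg]
  obtain ⟨x, hx⟩ := h.nonempty
  refine ⟨N, hN, fun r ↦ mul_right_cancel (b := x) ?_⟩
  have h₁ := key r 1 (by simpa using h.exists_left r) ⟨x, hx⟩
  have h₂ := key r s (h.exists_mul r) ⟨x, hx⟩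
  simp only [one_mul] at h₁
  rw [mul_assoc, h₂, mul_assoc, ← h₁, mul_assoc]

open Submonoid in
theorem exists_collect (h : IsNormalPair s X) (W : Set M) {w : M}
    (hw : w ∈ closure (insert s W)) (x : M) (hx : x ∈ X) :
    ∃ (n : ℕ), ∃ v ∈ closure W, ∃ x' ∈ X, w * x = s ^ n * (v * x') := by
  induction hw using closure_induction_left with
  | one => exact ⟨0, 1, one_mem _, x, hx, by simp⟩
  | mul_left g hg w _ ih =>
    obtain ⟨n, v, hv, x₁, h₁, e₁⟩ := ih
    rcases hg with rfl | hg
    · exact ⟨n + 1, v, hv, x₁, h₁, by rw [mul_assoc, e₁, pow_succ', mul_assoc]⟩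
    · obtain ⟨x₂, h₂, e₂⟩ := h.exists_left v x₁ h₁
      obtain ⟨x₃, h₃, e₃⟩ := h.exists_swap_pow g x₂ h₂ n
      obtain ⟨x₄, h₄, e₄⟩ := h.exists_right v x₃ h₃
      refine ⟨n, g * v, mul_mem (subset_closure hg) hv, x₄, h₄, ?_⟩
      rw [mul_assoc, e₁, e₂, ← mul_assoc (s ^ n), ← mul_assoc g, e₃, mul_assoc, mul_assoc, e₄,
        mul_assoc]

end IsNormalPair

theorem commute_of_mem_closure {M : Type*} [Monoid M] {A : Set M} {c s : M}
    (hc : c ∈ Submonoid.closure A) (h : ∀ a ∈ A, Commute a s) : Commute c s := by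
  induction hc using Submonoid.closure_induction with
  | mem c hc => exact h c hc
  | one => exact Commute.one_left s
  | mul a b _ _ ha hb => exact ha.mul_left hb

/-- Up to right multiplication by a fixed element, the submonoid generated by `W` is covered by
finitely many translates of the submonoid generated by the `n`-th powers. -/
theorem exists_finite_cover {M : Type*} [Monoid M]
    (H : ∀ s : M, ∃ X, IsNormalPair s X) (W : Finset M) {n : ℕ} (hn : n ≠ 0)
    (comm : ∀ r, ∀ s ∈ W, Commute (r ^ n) s) :
    ∃ (G : Set M) (t : M), G.Finite ∧ ∀ w ∈ Submonoid.closure (W : Set M),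
      ∃ c ∈ Submonoid.closure ((· ^ n) '' (W : Set M)), ∃ g ∈ G, w * t = c * g := by
  classical
  induction W using Finset.induction_on with
  | empty => exact ⟨{1}, 1, by simp⟩
  | insert s W _ ih =>
    obtain ⟨G, t, hG, ht⟩ := ih fun r s hs ↦ comm r s (Finset.mem_insert_of_mem hs)
    obtain ⟨X, hX⟩ := H s
    obtain ⟨x, hx⟩ := hX.nonempty
    have hfin : (Set.image2 (fun k (p : M × M) ↦ s ^ k * (p.1 * p.2)) (Set.Iio n)
        (G ×ˢ (X : Set M))).Finite :=
      (Set.finite_Iio n).image2 _ (hG.prod X.finite_toSet)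
    refine ⟨_, x * t, hfin, fun w hw ↦ ?_⟩
    rw [Finset.coe_insert] at hw
    obtain ⟨m, v, hv, x₁, h₁, e₁⟩ := hX.exists_collect _ hw x hx
    obtain ⟨x₂, h₂, e₂⟩ := hX.exists_right t x₁ h₁
    obtain ⟨c, hc, g, hg, e⟩ := ht v hv
    have hcs : Commute c (s ^ (m % n)) := by
      refine (commute_of_mem_closure hc ?_).pow_right _
      rintro _ ⟨r, -, rfl⟩
      exact comm r s (Finset.mem_insert_self s W)
    refine ⟨(s ^ n) ^ (m / n) * c, mul_mem (Submonoid.pow_mem _ (Submonoid.subset_closure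
      (Set.mem_image_of_mem _ (by simp))) _)
      (Submonoid.closure_mono (Set.image_mono (by simp)) hc), s ^ (m % n) * (g * x₂),
      ⟨m % n, Nat.mod_lt _ (Nat.pos_of_ne_zero hn), (g, x₂), ⟨hg, h₂⟩, rfl⟩, ?_⟩
    calc w * (x * t) = s ^ m * (v * (x₁ * t)) := by rw [← mul_assoc, e₁]; simp only [mul_assoc]
      _ = s ^ (n * (m / n) + m % n) * (c * (g * x₂)) := by
        rw [Nat.div_add_mod, e₂, ← mul_assoc v, e, mul_assoc]
      _ = (s ^ n) ^ (m / n) * ((s ^ (m % n) * c) * (g * x₂)) := by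
        rw [pow_add, pow_mul]; simp only [mul_assoc]
      _ = _ := by rw [← hcs.eq]; simp only [mul_assoc]

theorem exists_pow_comm_finset {M : Type*} [Monoid M] [IsCancelMul M]
    (H : ∀ s : M, ∃ X, IsNormalPair s X) (W : Finset M) :
    ∃ n ≠ 0, ∀ r, ∀ s ∈ W, Commute (r ^ n) s := by
  choose X hX using H
  choose N hN hc using fun s ↦ (hX s).exists_pow_comm
  refine ⟨∏ s ∈ W, N s, Finset.prod_ne_zero_iff.2 fun s _ ↦ hN s, fun r s hs ↦ ?_⟩
  obtain ⟨k, hk⟩ := Finset.dvd_prod_of_mem N hs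
  rw [hk, mul_comm, pow_mul]
  exact hc s _

open scoped IsMulCommutative in
theorem exists_uniqueProds_closure {M : Type*} [Monoid M] [IsCancelMul M] (W : Finset M) {n : ℕ}
    (comm : ∀ r, ∀ s ∈ W, Commute (r ^ n) s) :
    ∃ e ≠ 0, UniqueProds (Submonoid.closure ((· ^ (n * e)) '' (W : Set M))) := by
  have hcomm (k : ℕ) : IsMulCommutative (Submonoid.closure ((· ^ (n * k)) '' (W : Set M))) := by
    refine Submonoid.isMulCommutative_closure _ ?_
    rintro _ ⟨r, -, rfl⟩ _ ⟨s, hs, rfl⟩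
    simp only [pow_mul]
    exact (((comm r s hs).pow_right n).pow_pow k k).eq
  have hfg (k : ℕ) : Monoid.FG (Submonoid.closure ((· ^ (n * k)) '' (W : Set M))) :=
    (Monoid.fg_iff_submonoid_fg _).2
      ((Submonoid.fg_iff _).2 ⟨_, rfl, W.finite_toSet.image _⟩)
  let Z := Submonoid.closure ((· ^ (n * 1)) '' (W : Set M))
  have := hcomm 1
  let _ : CancelCommMonoid Z := { (inferInstance : CommMonoid Z) with
    mul_left_cancel := IsLeftRegular.all }
  have : Monoid.FG Z := hfg 1
  obtain ⟨e, he, h⟩ := exists_pow_eq_pow_of_pow_eq_pow Z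
  let C := Submonoid.closure ((· ^ (n * e)) '' (W : Set M))
  have := hcomm e
  let _ : CancelCommMonoid C := { (inferInstance : CommMonoid C) with
    mul_left_cancel := IsLeftRegular.all }
  have : Monoid.FG C := hfg e
  have hroot (c : C) : ∃ z : Z, (z : M) ^ e = c := by
    obtain ⟨c, hc⟩ := c
    induction hc using Submonoid.closure_induction with
    | mem c hc =>
      obtain ⟨s, hs, rfl⟩ := hc
      exact ⟨⟨s ^ (n * 1), Submonoid.subset_closure (Set.mem_image_of_mem _ hs)⟩, by
        simp [pow_mul]⟩
    | one => exact ⟨1, by simp⟩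
    | mul a b _ _ ha hb =>
      obtain ⟨⟨x, hx⟩, ⟨y, hy⟩⟩ := And.intro ha hb
      exact ⟨x * y, (congrArg Subtype.val (mul_pow x y e)).trans (congrArg₂ (· * ·) hx hy)⟩
  have : IsMulTorsionFree C := by
    refine ⟨fun m hm x y hxy ↦ ?_⟩
    obtain ⟨⟨x', hx⟩, ⟨y', hy⟩⟩ := And.intro (hroot x) (hroot y)
    have hxy : (x : M) ^ m = (y : M) ^ m := congrArg Subtype.val hxy
    rw [← hx, ← hy, ← pow_mul, ← pow_mul] at hxy
    apply Subtype.ext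
    rw [← hx, ← hy]
    exact congrArg Subtype.val (h x' y' (e * m) (mul_ne_zero he hm) (Subtype.ext hxy))
  exact ⟨e, he, inferInstanceAs (UniqueProds C)⟩

namespace MonoidAlgebra

variable {F M : Type*} [Field F] [Monoid M]

open scoped IsMulCommutative in
theorem isNonZeroDivisor_mapDomain_subtype [IsCancelMul M] (C : Submonoid M) [IsMulCommutative C]
    [UniqueProds C] {α : MonoidAlgebra F C} (hα : α ≠ 0) :
    IsNonZeroDivisor (mapDomain C.subtype α) := by
  have hsupp : α.coeff.support.Nonempty := by
    rwa [Finsupp.support_nonempty_iff, ne_eq, coeff_eq_zero]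
  have hcoeff {a : M} (ha : a ∈ (mapDomain C.subtype α).coeff.support) :
      ∃ c ∈ α.coeff.support, (c : M) = a := by
    classical
    simpa using Finsupp.mapDomain_support ha
  have hcoeff' {c : C} (hc : c ∈ α.coeff.support) :
      (mapDomain C.subtype α).coeff c ≠ 0 := by
    have : (mapDomain C.subtype α).coeff (C.subtype c) = α.coeff c :=
      Finsupp.mapDomain_apply C.subtype_injective _ _
    simpa [this] using hc
  constructor <;> intro x hx <;> by_contra hx0 <;>
    have hxs : x.coeff.support.Nonempty := by
      rwa [Finsupp.support_nonempty_iff, ne_eq, coeff_eq_zero]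
  · obtain ⟨a₀, ha₀, b₀, hb₀, hu⟩ := exists_unique_act (fun (c : C) (m : M) ↦ (c : M) * m)
      (fun c d m ↦ by simp [mul_assoc]) (fun c ↦ mul_right_injective _)
      (fun m c d h ↦ Subtype.ext (mul_right_cancel h)) hsupp hxs
    have huniq : UniqueMul (mapDomain C.subtype α).coeff.support x.coeff.support a₀ b₀ := by
      intro a b ha hb hab
      obtain ⟨c, hc, rfl⟩ := hcoeff ha
      obtain ⟨rfl, rfl⟩ := hu c hc b hb hab
      exact ⟨rfl, rfl⟩
    have := coeff_mul_mul_of_uniqueMul huniq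
    rw [hx] at this
    exact mul_ne_zero (hcoeff' ha₀) (Finsupp.mem_support_iff.1 hb₀) this.symm
  · obtain ⟨a₀, ha₀, b₀, hb₀, hu⟩ := exists_unique_act (fun (c : C) (m : M) ↦ m * (c : M))
      (fun c d m ↦ by rw [mul_comm c d]; simp [mul_assoc]) (fun c ↦ mul_left_injective _)
      (fun m c d h ↦ Subtype.ext (mul_left_cancel h)) hsupp hxs
    have huniq : UniqueMul x.coeff.support (mapDomain C.subtype α).coeff.support b₀ a₀ := by
      intro b a hb ha hab
      obtain ⟨c, hc, rfl⟩ := hcoeff ha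
      obtain ⟨rfl, rfl⟩ := hu c hc b hb hab
      exact ⟨rfl, rfl⟩
    have := coeff_mul_mul_of_uniqueMul huniq
    rw [hx] at this
    exact mul_ne_zero (Finsupp.mem_support_iff.1 hb₀) (hcoeff' ha₀) this.symm

theorem commute_mapDomain_subtype {C T : Submonoid M} (h : ∀ c ∈ C, ∀ w ∈ T, Commute c w)
    (α : MonoidAlgebra F C) (y : MonoidAlgebra F T) :
    Commute (mapDomain C.subtype α) (mapDomain T.subtype y) := by
  induction α using MonoidAlgebra.induction_linear with
  | zero => simp
  | add α β hα hβ => rw [mapDomain_add]; exact hα.add_left hβ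
  | single c f =>
    induction y using MonoidAlgebra.induction_linear with
    | zero => simp
    | add x y hx hy => rw [mapDomain_add]; exact hx.add_right hy
    | single w g =>
      simp [commute_iff_eq, mapDomain_single, single_mul_single, mul_comm f g,
        (h c c.2 w w.2).eq]

theorem exists_mapDomain_subtype_eq {T : Submonoid M} {x : MonoidAlgebra F M}
    (hx : ∀ m ∈ x.coeff.support, m ∈ T) : ∃ y : MonoidAlgebra F T, mapDomain T.subtype y = x :=
  ⟨_, mapDomain_comapDomain (fun m hm ↦ ⟨⟨m, hx m hm⟩, rfl⟩) T.subtype_injective⟩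

open Polynomial in
theorem _root_.exists_mul_eq_of_eval₂_eq_zero {A R : Type*} [CommRing A] [Ring R]
    (φ : A →+* R) {b : R} (hb : IsNonZeroDivisor b) (hcomm : ∀ α, Commute (φ α) b)
    (h : ∃ p : A[X], p ≠ 0 ∧ p.eval₂ φ b = 0) :
    ∃ α ≠ 0, ∃ c, b * c = φ α ∧ c * b = φ α := by
  obtain ⟨p, ⟨hp, hpb⟩, hmin⟩ := (InvImage.wf Polynomial.natDegree Nat.lt_wfRel.wf).has_min
    {p : A[X] | p ≠ 0 ∧ p.eval₂ φ b = 0} h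
  have hdecomp : p.divX.eval₂ φ b * b + φ (p.coeff 0) = 0 := by
    rw [← eval₂_mul_X, ← eval₂_C φ b, ← eval₂_add, divX_mul_X_add, hpb]
  have h0 : p.coeff 0 ≠ 0 := fun h0 ↦ by
    rw [h0, map_zero, add_zero] at hdecomp
    have hdiv := hb.2 _ hdecomp
    have hne : p.divX ≠ 0 := fun h ↦ hp <| by rw [← divX_mul_X_add p, h, h0]; simp
    refine hmin _ ⟨hne, hdiv⟩ ?_
    change p.divX.natDegree < p.natDegree
    have : Nontrivial A := Polynomial.nontrivial_iff.1 ⟨p, 0, hp⟩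
    conv_rhs => rw [← divX_mul_X_add p, h0, C_0, add_zero, natDegree_mul_X hne]
    exact Nat.lt_succ_self _
  have hcb : -p.divX.eval₂ φ b * b = φ (p.coeff 0) := by
    rw [neg_mul, neg_eq_iff_add_eq_zero, hdecomp]
  refine ⟨_, h0, _, ?_, hcb⟩
  rw [← sub_eq_zero]
  refine hb.2 _ ?_
  rw [sub_mul, mul_assoc, hcb, (hcomm _).eq, sub_self]

open Polynomial in
open scoped IsMulCommutative in
/-- Every non-zero-divisor `b` has a two-sided multiple that is a non-zero-divisor and commutes
with a given element `a`. -/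
theorem exists_regular_multiple [IsCancelMul M] (H : ∀ s : M, ∃ X, IsNormalPair s X)
    (a : MonoidAlgebra F M) {b : MonoidAlgebra F M} (hb : IsNonZeroDivisor b) :
    ∃ c d, IsNonZeroDivisor d ∧ b * c = d ∧ c * b = d ∧ Commute d a := by
  classical
  obtain ⟨W, ha, hbW⟩ : ∃ W : Finset M, a.coeff.support ⊆ W ∧ b.coeff.support ⊆ W :=
    ⟨_, Finset.subset_union_left, Finset.subset_union_right⟩
  obtain ⟨n, hn, hc⟩ := exists_pow_comm_finset H W
  obtain ⟨e, he, hu⟩ := exists_uniqueProds_closure W hc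
  have hc' : ∀ r, ∀ s ∈ W, Commute (r ^ (n * e)) s := fun r s hs ↦ by
    rw [mul_comm, pow_mul]; exact hc _ s hs
  obtain ⟨G, t, hG, ht⟩ := exists_finite_cover H W (mul_ne_zero hn he) hc'
  set C := Submonoid.closure ((· ^ (n * e)) '' (W : Set M))
  set T := Submonoid.closure (W : Set M)
  have hCT : ∀ c ∈ C, ∀ w ∈ T, Commute c w := fun c hc w hw ↦
    commute_of_mem_closure hc <| by
      rintro _ ⟨r, -, rfl⟩
      exact (commute_of_mem_closure hw fun s hs ↦ (hc' r s hs).symm).symm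
  have : IsMulCommutative C := Submonoid.isMulCommutative_closure _ <| by
    rintro _ ⟨r, -, rfl⟩ _ ⟨s, hs, rfl⟩
    exact ((hc' r s hs).pow_right _).eq
  obtain ⟨a, rfl⟩ := exists_mapDomain_subtype_eq (T := T) (x := a) fun m hm ↦
    Submonoid.subset_closure (ha hm)
  obtain ⟨b, rfl⟩ := exists_mapDomain_subtype_eq (T := T) (x := b) fun m hm ↦
    Submonoid.subset_closure (hbW hm)
  let φ : MonoidAlgebra F C →+* MonoidAlgebra F M := mapDomainRingHom F C.subtype
  let ψ : MonoidAlgebra F T →+* MonoidAlgebra F M := mapDomainRingHom F T.subtype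
  let _ : Module (MonoidAlgebra F C) (MonoidAlgebra F M) := Module.compHom _ φ
  have smul_def (α : MonoidAlgebra F C) (x : MonoidAlgebra F M) : α • x = φ α * x := rfl
  set τ : MonoidAlgebra F M := single t 1
  set Γ : Set (MonoidAlgebra F M) := (fun g ↦ single g 1) '' G
  have hspan (y : MonoidAlgebra F T) :
      ψ y * τ ∈ Submodule.span (MonoidAlgebra F C) Γ := by
    induction y using MonoidAlgebra.induction_linear with
    | zero => simp
    | add x y hx hy => rw [map_add, add_mul]; exact add_mem hx hy
    | single w f =>
      obtain ⟨c, hc, g, hg, hw⟩ := ht w w.2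
      have : ψ (single w f) * τ = (single ⟨c, hc⟩ f : MonoidAlgebra F C) • single g 1 := by
        simp [smul_def, φ, ψ, τ, hw]
      rw [this]
      exact Submodule.smul_mem _ _ (Submodule.subset_span ⟨g, hg, rfl⟩)
  have hdep : ¬ LinearIndependent (MonoidAlgebra F C) fun i : ℕ ↦ ψ (b ^ i) * τ := fun hli ↦ by
    have : Finite Γ := hG.image _
    have := hli.finite_of_le_span_finite _ Γ (by rintro _ ⟨i, rfl⟩; exact hspan _)
    exact not_finite ℕ
  have hτ (x : MonoidAlgebra F M) (hx : x * τ = 0) : x = 0 := by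
    ext m
    have := congrArg (fun y ↦ y.coeff (m * t)) hx
    simpa [τ] using this
  obtain ⟨α, hα, c, hbc, hcb⟩ := exists_mul_eq_of_eval₂_eq_zero φ hb
    (fun α ↦ commute_mapDomain_subtype hCT α b) <| by
      rw [linearIndependent_iff] at hdep
      push Not at hdep
      obtain ⟨l, hl, hl0⟩ := hdep
      refine ⟨⟨.ofCoeff l⟩, by simpa [← Polynomial.toFinsupp_eq_zero] using hl0, hτ _ ?_⟩
      rw [← hl, Finsupp.linearCombination_apply, eval₂_eq_sum, Polynomial.sum, Finset.sum_mul]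
      refine Finset.sum_congr rfl fun i _ ↦ ?_
      change φ (l i) * ψ b ^ i * τ = φ (l i) * (ψ (b ^ i) * τ)
      rw [map_pow, mul_assoc]
  exact ⟨c, φ α, isNonZeroDivisor_mapDomain_subtype C hα, hbc, hcb,
    commute_mapDomain_subtype hCT α a⟩

end MonoidAlgebra

theorem exists_mulHom_injective_eq_one_or_mem_range (S : Type*) [Semigroup S] [IsCancelMul S] :
    ∃ (M : Submonoid (Function.End S)) (f : S →ₙ* M), IsCancelMul M ∧ Function.Injective f ∧
      ∀ m, m = 1 ∨ m ∈ Set.range f := by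
  let M : Submonoid (Function.End S) :=
    { carrier := {g | g = 1 ∨ ∃ s : S, g = fun x ↦ s * x}
      one_mem' := .inl rfl
      mul_mem' := by
        rintro _ _ (rfl | ⟨s, rfl⟩) (rfl | ⟨t, rfl⟩)
        · exact .inl rfl
        · exact .inr ⟨t, rfl⟩
        · exact .inr ⟨s, rfl⟩
        · exact .inr ⟨s * t, funext fun x ↦ (mul_assoc s t x).symm⟩ }
  let f : S →ₙ* M :=
    { toFun s := ⟨fun x ↦ s * x, .inr ⟨s, rfl⟩⟩
      map_mul' s t := Subtype.ext <| funext fun x ↦ mul_assoc s t x }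
  have left_id {b y : S} (hb : y = b * y) (z : S) : z = b * z := by
    have hzb : z = z * b := mul_right_cancel (b := y) (by rw [mul_assoc, ← hb])
    exact mul_left_cancel (a := z) (by rw [← mul_assoc, ← hzb])
  have : IsLeftCancelMul M := by
    refine ⟨fun ⟨g, hg⟩ h k hhk ↦ Subtype.ext <| funext fun x ↦ ?_⟩
    have hx : g (h.1 x) = g (k.1 x) := congrFun (congrArg Subtype.val hhk) x
    rcases hg with rfl | ⟨s, rfl⟩
    exacts [hx, mul_left_cancel hx]
  have : IsRightCancelMul M := by
    refine ⟨fun ⟨g, hg⟩ ⟨h, hh⟩ ⟨k, hk⟩ hhk ↦ Subtype.ext <| funext fun x ↦ ?_⟩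
    have hx (x : S) : h (g x) = k (g x) := congrFun (congrArg Subtype.val hhk) x
    rcases hg with rfl | ⟨s, rfl⟩
    · exact hx x
    rcases hh with rfl | ⟨a, rfl⟩ <;> rcases hk with rfl | ⟨b, rfl⟩
    · rfl
    · exact left_id (hx x) x
    · exact (left_id (hx x).symm x).symm
    · exact congrArg (· * x) (mul_right_cancel (hx x))
  refine ⟨M, f, ⟨⟩, fun s t hst ↦ ?_, ?_⟩
  · exact mul_right_cancel (b := s) (congrFun (congrArg Subtype.val hst) s)
  · rintro ⟨g, rfl | ⟨s, rfl⟩⟩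
    exacts [.inl rfl, .inr ⟨s, rfl⟩]

section Transfer

variable {A B : Type*} [NonUnitalRing A] [Ring B]

theorem IsNonZeroDivisor.mul {x y : A} (hx : IsNonZeroDivisor x) (hy : IsNonZeroDivisor y) :
    IsNonZeroDivisor (x * y) :=
  ⟨fun z hz ↦ hy.1 z <| hx.1 _ <| by rwa [← mul_assoc],
    fun z hz ↦ hx.2 z <| hy.2 _ <| by rwa [mul_assoc]⟩

theorem IsNonZeroDivisor.of_map {ι : A →ₙ+* B} (hι : Function.Injective ι) {x : A}
    (hx : IsNonZeroDivisor (ι x)) : IsNonZeroDivisor x :=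
  ⟨fun z hz ↦ (map_eq_zero_iff ι hι).1 <| hx.1 _ <| by rw [← map_mul, hz, map_zero],
    fun z hz ↦ (map_eq_zero_iff ι hι).1 <| hx.2 _ <| by rw [← map_mul, hz, map_zero]⟩

theorem IsNonZeroDivisor.map {ι : A →ₙ+* B} (hι : Function.Injective ι) {σ : B}
    (hσ : IsNonZeroDivisor σ) (hl : ∀ x, ∃ z, ι z = σ * x) (hr : ∀ x, ∃ z, ι z = x * σ) {b : A}
    (hb : IsNonZeroDivisor b) : IsNonZeroDivisor (ι b) := by
  refine ⟨fun x hx ↦ hσ.2 x ?_, fun x hx ↦ hσ.1 x ?_⟩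
  · obtain ⟨z, hz⟩ := hr x
    rw [← hz, hb.1 z, map_zero]
    apply hι
    rw [map_mul, hz, ← mul_assoc, hx, zero_mul, map_zero]
  · obtain ⟨z, hz⟩ := hl x
    rw [← hz, hb.2 z, map_zero]
    apply hι
    rw [map_mul, hz, mul_assoc, hx, mul_zero, map_zero]

/-- The two Ore conditions descend from `B` to a subring containing a one-sided multiple by `σ`
of each element of `B`. -/
theorem ore_of_exists_regular_multiple {ι : A →ₙ+* B} (hι : Function.Injective ι) {σ : B}
    (hσ : IsNonZeroDivisor σ) (hl : ∀ x, ∃ z, ι z = σ * x) (hr : ∀ x, ∃ z, ι z = x * σ)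
    (H : ∀ a b : B, IsNonZeroDivisor b →
      ∃ c d, IsNonZeroDivisor d ∧ b * c = d ∧ c * b = d ∧ Commute d a) :
    (∀ a b : A, IsNonZeroDivisor b → ∃ c d : A, IsNonZeroDivisor d ∧ b * c = a * d) ∧
      (∀ a b : A, IsNonZeroDivisor b → ∃ c d : A, IsNonZeroDivisor d ∧ c * b = d * a) := by
  constructor <;> intro a b hb <;>
    obtain ⟨c, d, hd, hbc, hcb, hda⟩ := H (ι a) (ι b) (.map hι hσ hl hr hb)
  · obtain ⟨c', hc'⟩ := hr (c * ι a)
    obtain ⟨d', hd'⟩ := hr d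
    refine ⟨c', d', .of_map hι (hd' ▸ hd.mul hσ), hι ?_⟩
    rw [map_mul, map_mul, hc', hd', ← mul_assoc, ← mul_assoc, ← mul_assoc, hbc, hda.eq]
  · obtain ⟨c', hc'⟩ := hl (ι a * c)
    obtain ⟨d', hd'⟩ := hl d
    refine ⟨c', d', .of_map hι (hd' ▸ hσ.mul hd), hι ?_⟩
    rw [map_mul, map_mul, hc', hd', mul_assoc, mul_assoc, mul_assoc, hcb, hda.eq]

end Transfer

namespace MonoidAlgebra

variable {F S : Type*} [Field F] [Semigroup S] [IsCancelMul S]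

theorem isNonZeroDivisor_single (s : S) : IsNonZeroDivisor (single s 1 : MonoidAlgebra F S) := by
  classical
  constructor <;> intro x hx <;>
    have := congrArg (fun y ↦ y.coeff.support) hx <;>
    simpa [support_coeff_single_mul_eq_image x (r := (1 : F)) (by simp) (.all s),
      support_coeff_mul_single_eq_image x (r := (1 : F)) (by simp) (.all s)] using this

theorem image_support_eq_of_mem_center [DecidableEq S] {z : MonoidAlgebra F S}
    (hz : z ∈ Set.center (MonoidAlgebra F S)) (r : S) :
    z.coeff.support.image (r * ·) = z.coeff.support.image (· * r) := by
  rw [← support_coeff_single_mul_eq_image z (r := (1 : F)) (by simp) (.all r),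
    ← support_coeff_mul_single_eq_image z (r := (1 : F)) (by simp) (.all r),
    ((Set.mem_center_iff.1 hz).comm (single r 1)).eq]

theorem _root_.IsCentrallyEssential.exists_isNormalPair
    (h : IsCentrallyEssential (MonoidAlgebra F S)) (s : S) : ∃ X, IsNormalPair s X := by
  classical
  by_cases hs : (single s 1 : MonoidAlgebra F S) ∈ Set.center (MonoidAlgebra F S)
  · have hc (r : S) : r * s = s * r := by
      simpa [coeff_single, Finsupp.support_single] using
        image_support_eq_of_mem_center hs r
    refine ⟨{s}, by simp, by simp [hc], by simp [hc], fun r t ht ↦ ⟨t, ht, ?_⟩⟩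
    rw [Finset.mem_singleton.1 ht, ← mul_assoc, hc, mul_assoc, hc]
  obtain ⟨x, y, hx, hy, hx0, -, hxy⟩ := h _ hs
  refine ⟨x.coeff.support, ?_, fun r t ht ↦ ?_, fun r t ht ↦ ?_, fun r t ht ↦ ?_⟩
  · rwa [Finsupp.support_nonempty_iff, ne_eq, coeff_eq_zero]
  · have := Finset.mem_image_of_mem (r * ·) ht
    rw [image_support_eq_of_mem_center hx r] at this
    simpa [eq_comm] using this
  · have := Finset.mem_image_of_mem (· * r) ht
    rw [← image_support_eq_of_mem_center hx r] at this
    simpa [eq_comm] using this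
  · have hyx := support_coeff_single_mul_eq_image x (r := (1 : F)) (by simp) (.all s)
    rw [hxy] at hyx
    have := Finset.mem_image_of_mem (r * ·) (hyx ▸ Finset.mem_image_of_mem (s * ·) ht)
    rw [image_support_eq_of_mem_center hy r, hyx, Finset.image_image] at this
    simpa [eq_comm] using this

end MonoidAlgebra

theorem IsNormalPair.map {S M : Type*} [Semigroup S] [Monoid M] {f : S →ₙ* M}
    (hM : ∀ m, m = 1 ∨ m ∈ Set.range f) (H : ∀ s : S, ∃ X, IsNormalPair s X) (m : M) :
    ∃ X, IsNormalPair m X := by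
  classical
  rcases hM m with rfl | ⟨s, rfl⟩
  · exact ⟨{1}, by simp, by simp, by simp, by simp⟩
  obtain ⟨X, hX⟩ := H s
  refine ⟨X.image f, hX.nonempty.image f, fun r x hx ↦ ?_, fun r x hx ↦ ?_, fun r x hx ↦ ?_⟩ <;>
    rcases hM r with rfl | ⟨r, rfl⟩
  · exact ⟨x, hx, by simp⟩
  · obtain ⟨x, hxX, rfl⟩ := Finset.mem_image.1 hx
    obtain ⟨x', hx', e⟩ := hX.exists_left r x hxX
    exact ⟨f x', Finset.mem_image_of_mem f hx', by simp only [← map_mul, e]⟩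
  · exact ⟨x, hx, by simp⟩
  · obtain ⟨x, hxX, rfl⟩ := Finset.mem_image.1 hx
    obtain ⟨x', hx', e⟩ := hX.exists_right r x hxX
    exact ⟨f x', Finset.mem_image_of_mem f hx', by simp only [← map_mul, e]⟩
  · exact ⟨x, hx, by simp⟩
  · obtain ⟨x, hxX, rfl⟩ := Finset.mem_image.1 hx
    obtain ⟨x', hx', e⟩ := hX.exists_mul r x hxX
    exact ⟨f x', Finset.mem_image_of_mem f hx', by simp only [← map_mul, e]⟩

/-- If `S` is a cancellative semigroup and the semigroup algebra `F[S]` is centrally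
essential, then the non-zero-divisors of `F[S]` satisfy both the right Ore condition and
the left Ore condition, i.e., `F[S]` has a classical (two-sided) ring of fractions. -/
theorem stmt11 (F : Type*) [Field F] (S : Type*) [Semigroup S] [IsCancelMul S]
    (h : IsCentrallyEssential (MonoidAlgebra F S)) :
    (∀ a b : MonoidAlgebra F S, IsNonZeroDivisor b →
      ∃ c d : MonoidAlgebra F S, IsNonZeroDivisor d ∧ b * c = a * d) ∧
    (∀ a b : MonoidAlgebra F S, IsNonZeroDivisor b →
      ∃ c d : MonoidAlgebra F S, IsNonZeroDivisor d ∧ c * b = d * a) := by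
  classical
  rcases isEmpty_or_nonempty S with _ | ⟨⟨s⟩⟩
  · have : Subsingleton (MonoidAlgebra F S) := MonoidAlgebra.coeff_injective.subsingleton
    exact ⟨fun _ b hb ↦ ⟨b, b, hb, Subsingleton.elim _ _⟩,
      fun _ b hb ↦ ⟨b, b, hb, Subsingleton.elim _ _⟩⟩
  obtain ⟨M, f, _, hf, hM⟩ := exists_mulHom_injective_eq_one_or_mem_range S
  have hrange {x : MonoidAlgebra F M} (hx : ∀ m ∈ x.coeff.support, m ∈ Set.range f) :
      ∃ z, MonoidAlgebra.mapDomainNonUnitalRingHom F f z = x :=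
    ⟨_, MonoidAlgebra.mapDomain_comapDomain hx hf⟩
  refine ore_of_exists_regular_multiple (ι := MonoidAlgebra.mapDomainNonUnitalRingHom F f)
    (MonoidAlgebra.mapDomain_injective hf) (MonoidAlgebra.isNonZeroDivisor_single (f s))
    (fun x ↦ hrange fun m hm ↦ ?_) (fun x ↦ hrange fun m hm ↦ ?_)
    (fun a b hb ↦ MonoidAlgebra.exists_regular_multiple
      (IsNormalPair.map hM h.exists_isNormalPair) a hb)
  · obtain ⟨k, -, rfl⟩ := Finset.mem_image.1
      (MonoidAlgebra.support_coeff_single_mul_subset _ _ _ hm)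
    rcases hM k with rfl | ⟨t, rfl⟩
    exacts [⟨s, (mul_one _).symm⟩, ⟨s * t, map_mul f s t⟩]
  · obtain ⟨k, -, rfl⟩ := Finset.mem_image.1
      (MonoidAlgebra.support_coeff_mul_single_subset _ _ _ hm)
    rcases hM k with rfl | ⟨t, rfl⟩
    exacts [⟨s, (one_mul _).symm⟩, ⟨t * s, map_mul f t s⟩]
end

section
/- Let F be a field and let R be the set of all 7×7 matrices over F of the form with diagonal entries all equal to α, first row (α, a, b, c, d, e, f), and the only other nonzero off-diagonal entries being b in position (2,4), d in position (2,7), e in position (3,7), a in position (5,7), and b in position (6,7), where α, a, b, c, d, e, f range over F. Then R is a subring of the matrix ring M₇(F), R is not commutative, and R is a centrally essential ring. -/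
/-- The `7 × 7` matrix with parameters `α, a, b, c, d, e, f` of the shape studied below. -/
def paramMatrix {F : Type*} [Zero F] (α a b c d e f : F) : Matrix (Fin 7) (Fin 7) F :=
  !![α, a, b, c, d, e, f;
     0, α, 0, b, 0, 0, d;
     0, 0, α, 0, 0, 0, e;
     0, 0, 0, α, 0, 0, 0;
     0, 0, 0, 0, α, 0, a;
     0, 0, 0, 0, 0, α, b;
     0, 0, 0, 0, 0, 0, α]

theorem paramMatrix_mul {F : Type*} [CommRing F] (α a b c d e f α' a' b' c' d' e' f' : F) :
    paramMatrix α a b c d e f * paramMatrix α' a' b' c' d' e' f' =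
      paramMatrix (α * α') (α * a' + a * α') (α * b' + b * α') (α * c' + c * α' + a * b')
        (α * d' + d * α') (α * e' + e * α')
        (α * f' + f * α' + (a * d' + d * a') + (b * e' + e * b')) := by
  ext i j
  fin_cases i <;> fin_cases j <;>
    simp [paramMatrix, Matrix.mul_apply, Fin.sum_univ_succ] <;> ring

theorem paramMatrix_add {F : Type*} [AddZeroClass F] (α a b c d e f α' a' b' c' d' e' f' : F) :
    paramMatrix α a b c d e f + paramMatrix α' a' b' c' d' e' f' =
      paramMatrix (α + α') (a + a') (b + b') (c + c') (d + d') (e + e') (f + f') := by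
  ext i j
  fin_cases i <;> fin_cases j <;> simp [paramMatrix]

theorem paramMatrix_neg {F : Type*} [SubtractionMonoid F] (α a b c d e f : F) :
    -paramMatrix α a b c d e f = paramMatrix (-α) (-a) (-b) (-c) (-d) (-e) (-f) := by
  ext i j
  fin_cases i <;> fin_cases j <;> simp [paramMatrix]

theorem paramMatrix_zero {F : Type*} [Zero F] :
    paramMatrix (0 : F) 0 0 0 0 0 0 = 0 := by
  ext i j
  fin_cases i <;> fin_cases j <;> simp [paramMatrix]

theorem paramMatrix_one {F : Type*} [Zero F] [One F] :
    paramMatrix (1 : F) 0 0 0 0 0 0 = 1 := by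
  ext i j
  fin_cases i <;> fin_cases j <;> simp [paramMatrix]

/-- The subring of all matrices `paramMatrix α a b c d e f`. -/
def paramSubring (F : Type*) [CommRing F] : Subring (Matrix (Fin 7) (Fin 7) F) where
  carrier := { M | ∃ α a b c d e f : F, M = paramMatrix α a b c d e f }
  mul_mem' := by
    rintro _ _ ⟨α, a, b, c, d, e, f, rfl⟩ ⟨α', a', b', c', d', e', f', rfl⟩
    exact ⟨_, _, _, _, _, _, _, paramMatrix_mul ..⟩
  one_mem' := ⟨1, 0, 0, 0, 0, 0, 0, paramMatrix_one.symm⟩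
  add_mem' := by
    rintro _ _ ⟨α, a, b, c, d, e, f, rfl⟩ ⟨α', a', b', c', d', e', f', rfl⟩
    exact ⟨_, _, _, _, _, _, _, paramMatrix_add ..⟩
  zero_mem' := ⟨0, 0, 0, 0, 0, 0, 0, paramMatrix_zero.symm⟩
  neg_mem' := by
    rintro _ ⟨α, a, b, c, d, e, f, rfl⟩
    exact ⟨_, _, _, _, _, _, _, paramMatrix_neg ..⟩

/-- `paramMatrix α a b c d e f` as an element of `paramSubring F`. -/
def paramElem {F : Type*} [CommRing F] (α a b c d e f : F) : paramSubring F :=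
  ⟨paramMatrix α a b c d e f, α, a, b, c, d, e, f, rfl⟩

theorem exists_eq_paramElem {F : Type*} [CommRing F] (x : paramSubring F) :
    ∃ α a b c d e f : F, x = paramElem α a b c d e f := by
  obtain ⟨_, α, a, b, c, d, e, f, rfl⟩ := x
  exact ⟨α, a, b, c, d, e, f, rfl⟩

theorem paramElem_mul {F : Type*} [CommRing F] (α a b c d e f α' a' b' c' d' e' f' : F) :
    paramElem α a b c d e f * paramElem α' a' b' c' d' e' f' =
      paramElem (α * α') (α * a' + a * α') (α * b' + b * α') (α * c' + c * α' + a * b')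
        (α * d' + d * α') (α * e' + e * α')
        (α * f' + f * α' + (a * d' + d * a') + (b * e' + e * b')) :=
  Subtype.ext (paramMatrix_mul ..)

theorem paramElem_entry {F : Type*} [CommRing F] (α a b c d e f : F) (j : Fin 7) :
    (paramElem α a b c d e f).1 0 j = ![α, a, b, c, d, e, f] j := rfl

theorem paramElem_mem_center {F : Type*} [CommRing F] (α c d e f : F) :
    paramElem α 0 0 c d e f ∈ Set.center (paramSubring F) := by
  rw [Semigroup.mem_center_iff]
  intro x
  obtain ⟨α', a', b', c', d', e', f', rfl⟩ := exists_eq_paramElem x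
  rw [paramElem_mul, paramElem_mul]
  congr 1 <;> ring

theorem paramElem_ne_zero {F : Type*} [CommRing F] {α a b c d e f : F} (j : Fin 7)
    (h : ![α, a, b, c, d, e, f] j ≠ 0) : paramElem α a b c d e f ≠ 0 := fun h0 =>
  h (congrArg (fun x : paramSubring F => x.1 0 j) h0)

theorem not_commute_paramElem {F : Type*} [CommRing F] [Nontrivial F] :
    paramElem (0 : F) 1 0 0 0 0 0 * paramElem 0 0 1 0 0 0 0 ≠
      paramElem 0 0 1 0 0 0 0 * paramElem 0 1 0 0 0 0 0 := by
  intro h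
  rw [paramElem_mul, paramElem_mul] at h
  simpa [paramElem_entry] using congrArg (fun x : paramSubring F => x.1 0 3) h

theorem isCentrallyEssential_paramSubring (F : Type*) [Field F] :
    IsCentrallyEssential (paramSubring F) := by
  intro x hx
  obtain ⟨α, a, b, c, d, e, f, rfl⟩ := exists_eq_paramElem x
  by_cases hα : α = 0
  · subst hα
    by_cases ha : a = 0
    · subst ha
      have hb : b ≠ 0 := by
        rintro rfl
        exact hx (paramElem_mem_center ..)
      refine ⟨paramElem 0 0 0 0 0 1 0, paramElem 0 0 0 0 0 0 b, paramElem_mem_center ..,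
        paramElem_mem_center .., paramElem_ne_zero 5 one_ne_zero, paramElem_ne_zero 6 hb, ?_⟩
      simp [paramElem_mul]
    · refine ⟨paramElem 0 0 0 0 1 0 0, paramElem 0 0 0 0 0 0 a, paramElem_mem_center ..,
        paramElem_mem_center .., paramElem_ne_zero 4 one_ne_zero, paramElem_ne_zero 6 ha, ?_⟩
      simp [paramElem_mul]
  · refine ⟨paramElem 0 0 0 0 0 0 1, paramElem 0 0 0 0 0 0 α, paramElem_mem_center ..,
      paramElem_mem_center .., paramElem_ne_zero 6 one_ne_zero, paramElem_ne_zero 6 hα, ?_⟩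
    simp [paramElem_mul]

/-- The set of `7 × 7` matrices over a field `F` with constant diagonal `α`, first row
`(α, a, b, c, d, e, f)` and the only other nonzero off-diagonal entries `b` at `(2,4)`,
`d` at `(2,7)`, `e` at `(3,7)`, `a` at `(5,7)`, `b` at `(6,7)` is a noncommutative
centrally essential subring of `M₇(F)`. -/
theorem stmt13 (F : Type*) [Field F] :
    ∃ R : Subring (Matrix (Fin 7) (Fin 7) F),
      (R : Set (Matrix (Fin 7) (Fin 7) F)) =
        { M | ∃ α a b c d e f : F,
            M = !![α, a, b, c, d, e, f;
                   0, α, 0, b, 0, 0, d;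
                   0, 0, α, 0, 0, 0, e;
                   0, 0, 0, α, 0, 0, 0;
                   0, 0, 0, 0, α, 0, a;
                   0, 0, 0, 0, 0, α, b;
                   0, 0, 0, 0, 0, 0, α] } ∧
      (∃ x y : R, x * y ≠ y * x) ∧
      IsCentrallyEssential R := by
  exact ⟨paramSubring F, rfl, ⟨_, _, not_commute_paramElem⟩,
    isCentrallyEssential_paramSubring F⟩
end

section
/- Let F be a field of characteristic 2 and let G be a group whose commutator subgroup G' is a central subgroup of order 2, say G' = {e, z} with z ∈ Z(G) and z² = e. Then the group algebra FG is a centrally essential ring. (In particular, for every nonzero α ∈ FG, the element α·(e + z) lies in Z(FG), and if α·(e + z) = 0 then α itself lies in Z(FG).) -/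
theorem mul_eq_or_eq_mul_of_commutator_eq_zpowers {G : Type*} [Group G] {z : G}
    (hz_sq : z ^ 2 = 1) (hcomm : commutator G = Subgroup.zpowers z) (g h : G) :
    g * h = h * g ∨ g * h = z * (h * g) := by
  have hmem : g * h * g⁻¹ * h⁻¹ ∈ Subgroup.zpowers z := by
    rw [← hcomm, commutator_def, ← commutatorElement_def]
    exact Subgroup.commutator_mem_commutator (Subgroup.mem_top g) (Subgroup.mem_top h)
  obtain ⟨n, hn⟩ := Subgroup.mem_zpowers_iff.mp hmem
  have hgh : g * h = g * h * g⁻¹ * h⁻¹ * (h * g) := by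
    group
  have hz : z ^ (2 : ℤ) = 1 := by exact_mod_cast hz_sq
  rcases Int.even_or_odd' n with ⟨k, rfl | rfl⟩
  · left
    rw [hgh, ← hn, zpow_mul, hz, one_zpow, one_mul]
  · right
    rw [hgh, ← hn, zpow_add, zpow_mul, hz, one_zpow, one_mul, zpow_one]

theorem MonoidAlgebra.mem_center_of_forall_of_mul_eq {F G : Type*} [CommSemiring F] [Monoid G]
    {a : MonoidAlgebra F G}
    (h : ∀ g, MonoidAlgebra.of F G g * a = a * MonoidAlgebra.of F G g) :
    a ∈ Set.center (MonoidAlgebra F G) := by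
  rw [Semigroup.mem_center_iff]
  intro b
  induction b using MonoidAlgebra.induction_on with
  | of g => exact h g
  | add x y hx hy => rw [add_mul, mul_add, hx, hy]
  | smul r x hx => rw [smul_mul_assoc, mul_smul_comm, hx]

/-- Let `F` be a field of characteristic `2` and let `G` be a group whose commutator
subgroup is `{1, z}` with `z` a central element of order `2`. Then the group algebra
`F[G]` is centrally essential; moreover, for every nonzero `α ∈ F[G]`, the element
`α * (1 + z)` is central, and if `α * (1 + z) = 0` then `α` itself is central. -/
theorem stmt14 (F : Type*) [Field F] [CharP F 2]
    (G : Type*) [Group G] (z : G)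
    (hz_center : z ∈ Subgroup.center G) (hz_ne : z ≠ 1) (hz_sq : z ^ 2 = 1)
    (hcomm : commutator G = Subgroup.zpowers z) :
    IsCentrallyEssential (MonoidAlgebra F G) ∧
    ∀ α : MonoidAlgebra F G, α ≠ 0 →
      α * (1 + MonoidAlgebra.of F G z) ∈ Set.center (MonoidAlgebra F G) ∧
      (α * (1 + MonoidAlgebra.of F G z) = 0 → α ∈ Set.center (MonoidAlgebra F G)) := by
  have hswap := mul_eq_or_eq_mul_of_commutator_eq_zpowers hz_sq hcomm
  have hneg (a b : MonoidAlgebra F G) (h : a + b = 0) : a = b := by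
    have hb : b + b = 0 := by
      rw [← two_smul F b, CharTwo.two_eq_zero, zero_smul]
    exact add_right_cancel (h.trans hb.symm)
  set s : MonoidAlgebra F G := 1 + MonoidAlgebra.of F G z with hs
  have hs_center : s ∈ Set.center (MonoidAlgebra F G) := by
    refine MonoidAlgebra.mem_center_of_forall_of_mul_eq fun g => ?_
    rw [hs, mul_add, add_mul, mul_one, one_mul, ← map_mul, ← map_mul,
      Subgroup.mem_center_iff.mp hz_center g]
  have hzs : MonoidAlgebra.of F G z * s = s := by
    rw [hs, mul_add, mul_one, ← map_mul, ← pow_two, hz_sq, map_one, add_comm]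
  have hs_ne : s ≠ 0 := fun h =>
    hz_ne (MonoidAlgebra.of_injective (R := F) ((hneg _ _ h).symm.trans (map_one _).symm))
  have hs_comm := Semigroup.mem_center_iff.mp hs_center
  have hmul (a : MonoidAlgebra F G) : a * s ∈ Set.center (MonoidAlgebra F G) := by
    refine MonoidAlgebra.mem_center_of_forall_of_mul_eq fun g => ?_
    rw [mul_assoc a, ← hs_comm, ← mul_assoc, ← mul_assoc]
    induction a using MonoidAlgebra.induction_on with
    | of h =>
      rw [← map_mul, ← map_mul]
      rcases hswap g h with e | e
      · rw [e]
      · rw [e, map_mul, hs_comm, ← mul_assoc, ← hs_comm, hzs, hs_comm]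
    | add x y hx hy => rw [mul_add _ x y, add_mul, add_mul, add_mul, hx, hy]
    | smul r x hx => simp only [smul_mul_assoc, mul_smul_comm, hx]
  have hzero (a : MonoidAlgebra F G) (h : a * s = 0) : a ∈ Set.center (MonoidAlgebra F G) := by
    have ha : a = MonoidAlgebra.of F G z * a := by
      apply hneg
      rw [← h, hs_comm, hs, add_mul, one_mul]
    have hinv (g : G) : a.coeff (z * g) = a.coeff g := by
      conv_lhs => rw [ha]
      simp [MonoidAlgebra.of_apply]
    refine MonoidAlgebra.mem_center_of_forall_of_mul_eq fun g => ?_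
    ext k
    simp only [MonoidAlgebra.of_apply, MonoidAlgebra.coeff_single_mul_apply,
      MonoidAlgebra.coeff_mul_single_apply, one_mul, mul_one]
    rcases hswap g⁻¹ k with e | e
    · rw [e]
    · rw [e, hinv]
  refine ⟨fun a ha => ⟨s, a * s, hs_center, hmul a, hs_ne, fun h => ha (hzero a h), rfl⟩,
    fun a _ => ⟨hmul a, hzero a⟩⟩
end

section
/- Let F be a field and let G be the discrete Heisenberg group, i.e., the group of upper unitriangular 3×3 integer matrices (equivalently, the free nilpotent group of nilpotency class 2 on two generators, with presentation ⟨x, y, z | z central, x⁻¹y⁻¹xy = z⟩). Then the group algebra FG is not a centrally essential ring. -/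
/-- Relations for the discrete Heisenberg group
`⟨x, y, z ∣ z central, x⁻¹y⁻¹xy = z⟩` (generators `0 ↦ x`, `1 ↦ y`, `2 ↦ z`):
`z` commutes with `x` and with `y`, and `x⁻¹ * y⁻¹ * x * y = z`. -/
def heisenbergRels : Set (FreeGroup (Fin 3)) :=
  { FreeGroup.of 0 * FreeGroup.of 2 * (FreeGroup.of 0)⁻¹ * (FreeGroup.of 2)⁻¹,
    FreeGroup.of 1 * FreeGroup.of 2 * (FreeGroup.of 1)⁻¹ * (FreeGroup.of 2)⁻¹,
    (FreeGroup.of 0)⁻¹ * (FreeGroup.of 1)⁻¹ * FreeGroup.of 0 * FreeGroup.of 1 *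
      (FreeGroup.of 2)⁻¹ }

/-- The discrete Heisenberg group (the free nilpotent group of class 2 on two
generators). -/
abbrev HeisenbergGroup : Type := PresentedGroup heisenbergRels

/-- Integer triples `(a, b, c)`, standing for the unitriangular matrices with superdiagonal
entries `a`, `b` and corner entry `c`. -/
@[ext]
structure HeisenbergTriple where
  a : ℤ
  b : ℤ
  c : ℤ

namespace HeisenbergTriple

instance : Mul HeisenbergTriple := ⟨fun p q => ⟨p.a + q.a, p.b + q.b, p.c + q.c + p.a * q.b⟩⟩

instance : One HeisenbergTriple := ⟨⟨0, 0, 0⟩⟩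

instance : Inv HeisenbergTriple := ⟨fun p => ⟨-p.a, -p.b, -p.c + p.a * p.b⟩⟩

@[simp] lemma mul_def (p q : HeisenbergTriple) :
    p * q = ⟨p.a + q.a, p.b + q.b, p.c + q.c + p.a * q.b⟩ := rfl

@[simp] lemma one_def : (1 : HeisenbergTriple) = ⟨0, 0, 0⟩ := rfl

@[simp] lemma inv_def (p : HeisenbergTriple) :
    p⁻¹ = ⟨-p.a, -p.b, -p.c + p.a * p.b⟩ := rfl

instance : Group HeisenbergTriple :=
  Group.ofLeftAxioms (fun p q r => by ext <;> simp <;> ring) (fun p => by ext <;> simp)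
    (fun p => by ext <;> simp)

/-- The images of the three generators of the Heisenberg group. -/
def gen : Fin 3 → HeisenbergTriple := ![⟨1, 0, 0⟩, ⟨0, 1, 0⟩, ⟨0, 0, 1⟩]

lemma lift_gen_eq_one : ∀ r ∈ heisenbergRels, FreeGroup.lift gen r = 1 := by
  rintro r (rfl | rfl | rfl) <;> simp [gen]

/-- The homomorphism from the presented Heisenberg group to integer triples. -/
def ofPresented : HeisenbergGroup →* HeisenbergTriple :=
  PresentedGroup.toGroup lift_gen_eq_one

lemma ofPresented_of (i : Fin 3) : ofPresented (PresentedGroup.of i) = gen i :=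
  PresentedGroup.toGroup.of lift_gen_eq_one

lemma gen_one_pow (n : ℕ) : gen 1 ^ n = ⟨0, n, 0⟩ := by
  induction n with
  | zero => rfl
  | succ n ih => rw [pow_succ, ih]; simp [gen]

end HeisenbergTriple

open HeisenbergTriple

/-- Central elements of a group algebra are class functions. -/
lemma coeff_conj_of_mem_center {F G : Type*} [Field F] [Group G] {f : MonoidAlgebra F G}
    (hf : f ∈ Set.center (MonoidAlgebra F G)) (g h : G) :
    f.coeff (h⁻¹ * g * h) = f.coeff g := by
  have hc := (Set.mem_center_iff.mp hf).comm (MonoidAlgebra.single h 1)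
  have := congrArg (fun u : MonoidAlgebra F G => u.coeff (g * h)) hc
  simpa [MonoidAlgebra.coeff_mul_single_apply, MonoidAlgebra.coeff_single_mul_apply, mul_assoc]
    using this.symm

/-- Central elements of the group algebra are supported where the first coordinate vanishes. -/
lemma ofPresented_a_eq_zero {F : Type*} [Field F] {f : MonoidAlgebra F HeisenbergGroup}
    (hf : f ∈ Set.center (MonoidAlgebra F HeisenbergGroup)) {g : HeisenbergGroup}
    (hg : f.coeff g ≠ 0) : (ofPresented g).a = 0 := by
  by_contra ha
  let y : HeisenbergGroup := PresentedGroup.of 1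
  let conj : ℕ → HeisenbergGroup := fun n => (y ^ n)⁻¹ * g * y ^ n
  have hinj : Function.Injective conj := by
    intro m n hmn
    have h := congrArg (fun u => (ofPresented u).c) hmn
    simpa [conj, y, ofPresented_of, gen_one_pow, -inv_pow, ha] using h
  refine Set.infinite_range_of_injective hinj (f.coeff.support.finite_toSet.subset ?_)
  rintro _ ⟨n, rfl⟩
  simpa [conj, coeff_conj_of_mem_center hf] using hg

/-- For every field `F`, the group algebra of the discrete Heisenberg group over `F` is
not centrally essential. -/
theorem stmt15 (F : Type*) [Field F] :
    ¬ IsCentrallyEssential (MonoidAlgebra F HeisenbergGroup) := by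
  intro hess
  let x : HeisenbergGroup := PresentedGroup.of 0
  have hx : (ofPresented x).a = 1 := by simp [x, ofPresented_of, gen]
  have hcenter : MonoidAlgebra.single x (1 : F) ∉ Set.center _ := by
    intro h
    have := ofPresented_a_eq_zero h (g := x) (by simp)
    omega
  obtain ⟨c, d, hc, hd, hc0, -, hcd⟩ := hess _ hcenter
  obtain ⟨g, hg⟩ : ∃ g, c.coeff g ≠ 0 := by
    by_contra! h
    exact hc0 (MonoidAlgebra.ext (Finsupp.ext h))
  have hxg : d.coeff (x * g) ≠ 0 := by
    simpa [← hcd, MonoidAlgebra.coeff_single_mul_apply] using hg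
  have h1 := ofPresented_a_eq_zero hc hg
  have h2 := ofPresented_a_eq_zero hd hxg
  simp [hx, h1] at h2
end
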